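/- arXiv:math/9807144 — 6 statements merged into one kernel-verified Lean document; each statement's English description precedes it below -/
import Mathlib

section
/- Let M be an H_ℓ-module and let U ⊆ M be a ℂ[W_ℓ]-submodule which is simple as a ℂ[W_ℓ]-module and which generates M as an H_ℓ-module. If D_ℓ(U) ≠ 0, then D_ℓ(U) generates D_ℓ(M) over Y(gl_n); that is, the smallest Y(gl_n)-submodule of D_ℓ(M) containing D_ℓ(U) is D_ℓ(M) itself. -/
set_option synthInstance.maxHeartbeats 1000000
set_option maxHeartbeats 1000000

noncomputable section

open scoped TensorProduct

/-- Generators of the degenerate affine Hecke algebra `H_ℓ`: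
the group elements `w ∈ W_ℓ` and the polynomial generators `ε_i`. -/
inductive HGen (ℓ : ℕ) : Type
  | perm : Equiv.Perm (Fin ℓ) → HGen ℓ
  | eps : Fin ℓ → HGen ℓ

/-- Defining relations of the degenerate affine Hecke algebra: `ℂ[W_ℓ]` is a subalgebra,
`ℂ[ε_1,…,ε_ℓ]` is a (commutative polynomial) subalgebra, and the cross relation
`s_i ε_j − ε_{s_i(j)} s_i = −(δ_{i,j} − δ_{i+1,j})`. -/
inductive HRel (ℓ : ℕ) : FreeAlgebra ℂ (HGen ℓ) → FreeAlgebra ℂ (HGen ℓ) → Prop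
  | permMul (w w' : Equiv.Perm (Fin ℓ)) :
      HRel ℓ (FreeAlgebra.ι ℂ (HGen.perm w) * FreeAlgebra.ι ℂ (HGen.perm w'))
        (FreeAlgebra.ι ℂ (HGen.perm (w * w')))
  | permOne :
      HRel ℓ (FreeAlgebra.ι ℂ (HGen.perm 1)) 1
  | epsComm (i j : Fin ℓ) :
      HRel ℓ (FreeAlgebra.ι ℂ (HGen.eps i) * FreeAlgebra.ι ℂ (HGen.eps j))
        (FreeAlgebra.ι ℂ (HGen.eps j) * FreeAlgebra.ι ℂ (HGen.eps i))
  | cross (i j : Fin ℓ) (h : (i : ℕ) + 1 < ℓ) :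
      HRel ℓ
        (FreeAlgebra.ι ℂ (HGen.perm (Equiv.swap i ⟨(i : ℕ) + 1, h⟩)) *
            FreeAlgebra.ι ℂ (HGen.eps j) -
          FreeAlgebra.ι ℂ (HGen.eps (Equiv.swap i ⟨(i : ℕ) + 1, h⟩ j)) *
            FreeAlgebra.ι ℂ (HGen.perm (Equiv.swap i ⟨(i : ℕ) + 1, h⟩)))
        ((-(((if j = i then 1 else 0) : ℂ) - (if j = ⟨(i : ℕ) + 1, h⟩ then 1 else 0))) • 1)

/-- The degenerate affine Hecke algebra `H_ℓ`, as the algebra presented by the above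
generators and relations. -/
abbrev Hecke (ℓ : ℕ) : Type := RingQuot (HRel ℓ)

/-- The image of `w ∈ W_ℓ` in `H_ℓ`. -/
def Hecke.sigma {ℓ : ℕ} (w : Equiv.Perm (Fin ℓ)) : Hecke ℓ :=
  RingQuot.mkAlgHom ℂ (HRel ℓ) (FreeAlgebra.ι ℂ (HGen.perm w))

/-- The image of `ε_i` in `H_ℓ`. -/
def Hecke.eps {ℓ : ℕ} (i : Fin ℓ) : Hecke ℓ :=
  RingQuot.mkAlgHom ℂ (HRel ℓ) (FreeAlgebra.ι ℂ (HGen.eps i))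

/-- The elements `y_m := ε_m − Σ_{j<m} s_{jm}` of `H_ℓ`. -/
def Hecke.y {ℓ : ℕ} (m : Fin ℓ) : Hecke ℓ :=
  Hecke.eps m - ∑ j ∈ Finset.univ.filter (fun j : Fin ℓ => j < m), Hecke.sigma (Equiv.swap j m)

/-- Index type for the Yangian generators `t_{ij}^{(d)}`. -/
def tIdx (n : ℕ) : Type := Fin n × Fin n × ℕ

/-- `t_{ij}^{(d)}` in the free algebra, for `d : ℤ`, with the convention
`t_{ij}^{(-1)} = δ_{ij}·1` (and junk value `0` for `d ≤ -2`, which never occurs). -/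
def tFree {n : ℕ} (i j : Fin n) (d : ℤ) : FreeAlgebra ℂ (tIdx n) :=
  if d = -1 then (if i = j then 1 else 0)
  else if 0 ≤ d then FreeAlgebra.ι ℂ ((i, j, d.toNat) : tIdx n) else 0

/-- Defining relations of the Yangian `Y(gl_n)`:
`[t_{ij}^{(r)}, t_{kl}^{(s−1)}] − [t_{ij}^{(r−1)}, t_{kl}^{(s)}]
  = t_{kj}^{(r−1)} t_{il}^{(s−1)} − t_{kj}^{(s−1)} t_{il}^{(r−1)}`. -/
inductive YRel (n : ℕ) : FreeAlgebra ℂ (tIdx n) → FreeAlgebra ℂ (tIdx n) → Prop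
  | rel (i j k l : Fin n) (r s : ℕ) :
      YRel n
        (tFree i j (r : ℤ) * tFree k l ((s : ℤ) - 1) - tFree k l ((s : ℤ) - 1) * tFree i j (r : ℤ)
          - (tFree i j ((r : ℤ) - 1) * tFree k l (s : ℤ)
              - tFree k l (s : ℤ) * tFree i j ((r : ℤ) - 1)))
        (tFree k j ((r : ℤ) - 1) * tFree i l ((s : ℤ) - 1) -
          tFree k j ((s : ℤ) - 1) * tFree i l ((r : ℤ) - 1))

/-- The Yangian `Y(gl_n)`. -/
abbrev Yangian (n : ℕ) : Type := RingQuot (YRel n)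

/-- The generator `t_{ij}^{(d)}`, `d ≥ 0`, of the Yangian. -/
def Yangian.t {n : ℕ} (i j : Fin n) (d : ℕ) : Yangian n :=
  RingQuot.mkAlgHom ℂ (YRel n) (FreeAlgebra.ι ℂ ((i, j, d) : tIdx n))

/-! ## The Drinfeld functor -/

/-- Words of length `ℓ` in the alphabet `{1,…,n}`: the standard basis of `(ℂ^n)^{⊗ℓ}`
is indexed by such words. -/
abbrev Word (ℓ n : ℕ) : Type := Fin ℓ → Fin n

/-- Concrete model for `M ⊗ (ℂ^n)^{⊗ℓ}`: functions from words to `M`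
(the value at a word is the coefficient of the corresponding basis vector). -/
abbrev MW (ℓ n : ℕ) (M : Type) : Type := Word ℓ n → M

section Dfun

variable {ℓ n : ℕ} {M : Type} [AddCommGroup M] [Module ℂ M]

/-- The operator `P_σ` permuting the tensor factors of `(ℂ^n)^{⊗ℓ}`. -/
def permOp (n : ℕ) {ℓ : ℕ} {M : Type} [AddCommGroup M] [Module ℂ M]
    (σ : Equiv.Perm (Fin ℓ)) : MW ℓ n M →ₗ[ℂ] MW ℓ n M where
  toFun f := fun w => f (w ∘ σ)
  map_add' _ _ := rfl
  map_smul' _ _ := rfl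

/-- The operator `τ_m(E_{ab})`, acting as the matrix unit `E_{ab}` on the `m`-th
tensor factor of `(ℂ^n)^{⊗ℓ}` and as the identity elsewhere. -/
def tauOp {ℓ n : ℕ} {M : Type} [AddCommGroup M] [Module ℂ M]
    (m : Fin ℓ) (a b : Fin n) : MW ℓ n M →ₗ[ℂ] MW ℓ n M where
  toFun f := fun w => if w m = a then f (Function.update w m b) else 0
  map_add' f g := by funext w; by_cases h : w m = a <;> simp [h]
  map_smul' c f := by funext w; by_cases h : w m = a <;> simp [h]

/-- The action of `h ∈ H_ℓ` on the coefficients (i.e. on the factor `M`). -/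
def hOp (n : ℕ) {ℓ : ℕ} {M : Type} [AddCommGroup M] [Module ℂ M]
    (ρ : Hecke ℓ →ₐ[ℂ] Module.End ℂ M) (h : Hecke ℓ) : MW ℓ n M →ₗ[ℂ] MW ℓ n M :=
  (ρ h).compLeft (Word ℓ n)

/-- The action of the transposition `s_{ij} ∈ W_ℓ` on `M ⊗ (ℂ^n)^{⊗ℓ}`, namely
`K_{ij} P_{ij}`. -/
def sOp (n : ℕ) {ℓ : ℕ} {M : Type} [AddCommGroup M] [Module ℂ M]
    (ρ : Hecke ℓ →ₐ[ℂ] Module.End ℂ M) (i j : Fin ℓ) : MW ℓ n M →ₗ[ℂ] MW ℓ n M :=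
  hOp n ρ (Hecke.sigma (Equiv.swap i j)) ∘ₗ permOp n (Equiv.swap i j)

/-- The subspace `N(M) = Σ_{i=1}^{ℓ-1} Im(s_i + 1)` of `M ⊗ (ℂ^n)^{⊗ℓ}`. -/
def NSub (n : ℕ) {ℓ : ℕ} {M : Type} [AddCommGroup M] [Module ℂ M]
    (ρ : Hecke ℓ →ₐ[ℂ] Module.End ℂ M) : Submodule ℂ (MW ℓ n M) :=
  ⨆ (i : Fin ℓ) (h : (i : ℕ) + 1 < ℓ),
    LinearMap.range (sOp n ρ i ⟨(i : ℕ) + 1, h⟩ + LinearMap.id)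

/-- The Drinfeld functor: `D_ℓ(M) = (M ⊗ (ℂ^n)^{⊗ℓ})/N(M)`. -/
abbrev Dmod (n : ℕ) {ℓ : ℕ} {M : Type} [AddCommGroup M] [Module ℂ M]
    (ρ : Hecke ℓ →ₐ[ℂ] Module.End ℂ M) : Type :=
  MW ℓ n M ⧸ NSub n ρ

/-- The operator `Σ_{m=1}^{ℓ} y_m^d ⊗ τ_m(E_{ab})` on `M ⊗ (ℂ^n)^{⊗ℓ}`. -/
def sumOp (n : ℕ) {ℓ : ℕ} {M : Type} [AddCommGroup M] [Module ℂ M]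
    (ρ : Hecke ℓ →ₐ[ℂ] Module.End ℂ M) (a b : Fin n) (d : ℕ) :
    MW ℓ n M →ₗ[ℂ] MW ℓ n M :=
  ∑ m : Fin ℓ, hOp n ρ ((Hecke.y m) ^ d) ∘ₗ tauOp m a b

/-- `π` is the Yangian action on `D_ℓ(M)` provided by Propositions 2.1 and 2.4 of
the paper: `t_{ab}^{(d)}` acts by the endomorphism induced by
`Σ_{m=1}^{ℓ} y_m^d ⊗ τ_m(E_{ab})`. -/
def IsDrinfeldAction (n : ℕ) {ℓ : ℕ} {M : Type} [AddCommGroup M] [Module ℂ M]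
    (ρ : Hecke ℓ →ₐ[ℂ] Module.End ℂ M)
    (π : Yangian n →ₐ[ℂ] Module.End ℂ (Dmod n ρ)) : Prop :=
  ∀ (a b : Fin n) (d : ℕ) (f : MW ℓ n M),
    π (Yangian.t a b d) (Submodule.Quotient.mk f) = Submodule.Quotient.mk (sumOp n ρ a b d f)

/-- A subspace stable under a Yangian action: a `Y(gl_n)`-submodule. -/
def YStable {n : ℕ} {V : Type} [AddCommGroup V] [Module ℂ V]
    (π : Yangian n →ₐ[ℂ] Module.End ℂ V) (q : Submodule ℂ V) : Prop :=
  ∀ (y : Yangian n) (x : V), x ∈ q → π y x ∈ q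

/-- A nonzero `Y(gl_n)`-module with no proper nonzero submodule: a simple module. -/
def YSimple {n : ℕ} {V : Type} [AddCommGroup V] [Module ℂ V]
    (π : Yangian n →ₐ[ℂ] Module.End ℂ V) : Prop :=
  Nontrivial V ∧ ∀ q : Submodule ℂ V, YStable π q → q = ⊥ ∨ q = ⊤

/-- A subspace stable under an `H_ℓ`-action: an `H_ℓ`-submodule. -/
def HStable {ℓ : ℕ} {M : Type} [AddCommGroup M] [Module ℂ M]
    (ρ : Hecke ℓ →ₐ[ℂ] Module.End ℂ M) (p : Submodule ℂ M) : Prop :=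
  ∀ (h : Hecke ℓ) (x : M), x ∈ p → ρ h x ∈ p

/-- A nonzero `H_ℓ`-module with no proper nonzero submodule: a simple module. -/
def HSimple {ℓ : ℕ} {M : Type} [AddCommGroup M] [Module ℂ M]
    (ρ : Hecke ℓ →ₐ[ℂ] Module.End ℂ M) : Prop :=
  Nontrivial M ∧ ∀ p : Submodule ℂ M, HStable ρ p → p = ⊥ ∨ p = ⊤

end Dfun

section Filtration

variable {E : Type*} [AddCommGroup E] [Module ℂ E]

/-- `T` raises the degree of the filtration `G` by at most `d`. -/
def RaisesBy (G : ℕ → Submodule ℂ E) (T : Module.End ℂ E) (d : ℕ) : Prop :=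
  ∀ k, ∀ x ∈ G k, T x ∈ G (k + d)

/-- `T` raises the degree of the filtration `G` by strictly less than `d`. -/
def RaisesLt (G : ℕ → Submodule ℂ E) (T : Module.End ℂ E) (d : ℕ) : Prop :=
  ∀ k, ∀ x ∈ G (k + 1), T x ∈ G (k + d)

variable {G : ℕ → Submodule ℂ E} {S T : Module.End ℂ E} {d e : ℕ}

theorem RaisesBy.one : RaisesBy G 1 0 := fun _ _ hx => hx

theorem RaisesBy.mul (hS : RaisesBy G S d) (hT : RaisesBy G T e) :
    RaisesBy G (S * T) (d + e) := fun k x hx => by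
  have := hS _ _ (hT k x hx)
  rwa [add_assoc, add_comm e] at this

theorem RaisesBy.sub (hS : RaisesBy G S d) (hT : RaisesBy G T d) :
    RaisesBy G (S - T) d := fun k x hx => (G _).sub_mem (hS k x hx) (hT k x hx)

theorem RaisesBy.pow (hT : RaisesBy G T d) (p : ℕ) : RaisesBy G (T ^ p) (p * d) := by
  induction p with
  | zero => simpa using RaisesBy.one
  | succ p ih => rw [pow_succ, add_mul, one_mul]; exact ih.mul hT

theorem RaisesBy.raisesLt (hT : RaisesBy G T d) : RaisesLt G T (d + 1) := fun k x hx => by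
  have := hT _ x hx
  rwa [add_assoc, add_comm 1] at this

theorem RaisesLt.zero : RaisesLt G 0 d := fun _ _ _ => (G _).zero_mem

theorem RaisesLt.add (hS : RaisesLt G S d) (hT : RaisesLt G T d) :
    RaisesLt G (S + T) d := fun k x hx => (G _).add_mem (hS k x hx) (hT k x hx)

theorem RaisesLt.neg (hT : RaisesLt G T d) : RaisesLt G (-T) d :=
  fun k x hx => (G _).neg_mem (hT k x hx)

theorem RaisesLt.mul_raisesBy (hS : RaisesLt G S d) (hT : RaisesBy G T e) :
    RaisesLt G (S * T) (d + e) := fun k x hx => by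
  have h := hT _ x hx
  rw [show k + 1 + e = k + e + 1 by omega] at h
  have := hS _ _ h
  rwa [add_assoc, add_comm e] at this

theorem RaisesBy.mul_raisesLt (hS : RaisesBy G S d) (hT : RaisesLt G T e) :
    RaisesLt G (S * T) (d + e) := fun k x hx => by
  have := hS _ _ (hT k x hx)
  rwa [add_assoc, add_comm e] at this

theorem RaisesLt.commutator_pow (hT : RaisesBy G T e)
    (h : RaisesLt G (S * T - T * S) (d + e)) (q : ℕ) :
    RaisesLt G (S * T ^ q - T ^ q * S) (d + q * e) := by
  induction q with
  | zero => simpa using RaisesLt.zero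
  | succ q ih =>
    have h1 := ih.mul_raisesBy hT
    have h2 := (hT.pow q).mul_raisesLt h
    rw [show q * e + (d + e) = d + q * e + e by ring] at h2
    have := h1.add h2
    rw [show d + (q + 1) * e = d + q * e + e by ring]
    convert this using 1
    rw [pow_succ]
    noncomm_ring

theorem RaisesLt.pow_commutator_pow (hS : RaisesBy G S d) (hT : RaisesBy G T e)
    (h : RaisesLt G (S * T - T * S) (d + e)) (p q : ℕ) :
    RaisesLt G (S ^ p * T ^ q - T ^ q * S ^ p) (p * d + q * e) := by
  have h1 := (RaisesLt.commutator_pow hT h q).neg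
  rw [neg_sub, add_comm] at h1
  have h2 := (RaisesLt.commutator_pow hS h1 p).neg
  rwa [neg_sub, add_comm] at h2

theorem RaisesBy.list_prod {r : ℕ} {b : Fin r → Module.End ℂ E} {e : Fin r → ℕ}
    (hb : ∀ j, RaisesBy G (b j) (e j)) : RaisesBy G (List.ofFn b).prod (∑ j, e j) := by
  induction r with
  | zero => simpa using RaisesBy.one
  | succ r ih =>
    rw [List.ofFn_succ, List.prod_cons, Fin.sum_univ_succ]
    exact (hb 0).mul (ih fun j => hb j.succ)

/-- An operator commuting with the factors of a product up to lower order terms can be moved into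
any position of the product, up to lower order terms. -/
theorem RaisesLt.mul_list_prod_sub {r : ℕ} {b : Fin r → Module.End ℂ E} {e : Fin r → ℕ}
    (hb : ∀ j, RaisesBy G (b j) (e j)) (i : Fin r)
    (h : ∀ j, j ≠ i → RaisesLt G (T * b j - b j * T) (d + e j)) :
    RaisesLt G (T * (List.ofFn b).prod - (List.ofFn (Function.update b i (T * b i))).prod)
      (d + ∑ j, e j) := by
  induction r with
  | zero => exact i.elim0
  | succ r ih =>
    rw [List.ofFn_succ, List.ofFn_succ, List.prod_cons, List.prod_cons, Fin.sum_univ_succ]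
    refine Fin.cases ?_ (fun i h => ?_) i h
    · intro _
      simpa [Function.update_of_ne, mul_assoc] using RaisesLt.zero
    · have h1 := (h 0 (Fin.succ_ne_zero i).symm).mul_raisesBy
        (RaisesBy.list_prod fun j => hb j.succ)
      have h2 := (hb 0).mul_raisesLt (ih (fun j => hb j.succ) i
        fun j hj => h j.succ (by simpa using hj))
      rw [show e 0 + (d + ∑ j : Fin r, e j.succ) = d + e 0 + ∑ j : Fin r, e j.succ by ring] at h2
      have h3 := h1.add h2
      rw [add_assoc] at h3
      convert h3 using 1
      have : (fun j : Fin r => Function.update b i.succ (T * b i.succ) j.succ) =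
          Function.update (fun j : Fin r => b j.succ) i (T * b i.succ) := by
        funext j
        by_cases hj : j = i
        · subst hj; simp
        · simp [Function.update_of_ne, hj]
      rw [this, Function.update_of_ne (Fin.succ_ne_zero i).symm]
      noncomm_ring

/-- Sums of injectively placed products can be obtained from sums over a single place. -/
theorem sum_injective_list_prod_mem {α ι : Type*} [Fintype ι] [DecidableEq ι]
    (deg : α → ℕ) (A : α → ι → Module.End ℂ E)
    (hA : ∀ a m, RaisesBy G (A a m) (deg a))
    (hcomm : ∀ a b m m', m ≠ m' →
      RaisesLt G (A a m * A b m' - A b m' * A a m) (deg a + deg b))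
    (hmul : ∀ a b, (∀ m, A a m * A b m = 0) ∨
      ∃ c, deg c = deg a + deg b ∧ ∀ m, A a m * A b m = A c m)
    (q : Submodule ℂ E) (hq : ∀ a, ∀ x ∈ q, (∑ m, A a m) x ∈ q)
    (K : ℕ) (hGq : ∀ k ≤ K, G k ≤ q) (g : E) (hg : g ∈ q) (hgG : g ∈ G 1)
    {r : ℕ} (L : Fin r → α) (hL : ∑ i, deg (L i) ≤ K) :
    ∑ m : Fin r → ι with Function.Injective m,
      (List.ofFn fun i => A (L i) (m i)).prod g ∈ q := by
  induction r with
  | zero =>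
    refine Submodule.sum_mem _ fun m _ => ?_
    simpa using hg
  | succ r ih =>
    have hL' := hL
    rw [Fin.sum_univ_succ] at hL'
    have hmem := hq (L 0) _ (ih (fun i => L i.succ) (by omega))
    -- split off the position of the first factor
    have key : (∑ m : Fin (r + 1) → ι with Function.Injective m,
          (List.ofFn fun i => A (L i) (m i)).prod g) =
        (∑ m, A (L 0) m) (∑ m : Fin r → ι with Function.Injective m,
          (List.ofFn fun i => A (L i.succ) (m i)).prod g) -
        ∑ i : Fin r, ∑ m : Fin r → ι with Function.Injective m,
          (A (L 0) (m i) * (List.ofFn fun i => A (L i.succ) (m i)).prod) g := by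
      rw [Finset.sum_filter, ← (Fin.consEquiv fun _ => ι).sum_comp, Fintype.sum_prod_type,
        Finset.sum_comm, map_sum, Finset.sum_comm (γ := Fin r), ← Finset.sum_sub_distrib,
        Finset.sum_filter]
      refine Finset.sum_congr rfl fun m _ => ?_
      have hinj : ∀ p, Function.Injective (Fin.consEquiv (fun _ => ι) (p, m)) ↔
          p ∉ Set.range m ∧ Function.Injective m := fun p => Fin.cons_injective_iff
      by_cases hm : Function.Injective m
      · simp only [hinj, hm, and_true, if_true, Fin.consEquiv_apply,
          List.ofFn_succ, Fin.cons_zero, Fin.cons_succ, List.prod_cons]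
        rw [LinearMap.sum_apply, eq_sub_iff_add_eq]
        rw [← Finset.sum_image (s := Finset.univ) (g := m)
          (f := fun p => (A (L 0) p * (List.ofFn fun i => A (L i.succ) (m i)).prod) g)
          (fun _ _ _ _ h => hm h), ← Finset.sum_filter]
        rw [show Finset.univ.image m = Finset.univ.filter (fun p => ¬ p ∉ Set.range m) by
          ext p; simp]
        rw [Finset.sum_filter_add_sum_filter_not]
        rfl
      · simp [hinj, hm]
    rw [key]
    refine q.sub_mem hmem (q.sum_mem fun i _ => ?_)
    -- merge the two factors placed at the same position
    have hlow : ∀ m : Fin r → ι, Function.Injective m →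
        (A (L 0) (m i) * (List.ofFn fun i => A (L i.succ) (m i)).prod) g -
          (List.ofFn (Function.update (fun i => A (L i.succ) (m i)) i
            (A (L 0) (m i) * A (L i.succ) (m i)))).prod g ∈ q := fun m hm => by
      have := RaisesLt.mul_list_prod_sub (T := A (L 0) (m i)) (d := deg (L 0))
        (b := fun i => A (L i.succ) (m i)) (e := fun i => deg (L i.succ))
        (fun j => hA _ _) i (fun j hj => hcomm _ _ _ _ fun h => hj (hm h).symm) 0 g
        (by simpa using hgG)
      exact hGq _ (by omega) this
    rw [← sub_add_cancel (∑ m : Fin r → ι with Function.Injective m,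
          (A (L 0) (m i) * (List.ofFn fun i => A (L i.succ) (m i)).prod) g)
        (∑ m : Fin r → ι with Function.Injective m, (List.ofFn
          (Function.update (fun i => A (L i.succ) (m i)) i
            (A (L 0) (m i) * A (L i.succ) (m i)))).prod g), ← Finset.sum_sub_distrib]
    refine q.add_mem (q.sum_mem fun m hm => hlow m (Finset.mem_filter.1 hm).2) ?_
    rcases hmul (L 0) (L i.succ) with h0 | ⟨c, hc, hcA⟩
    · refine q.sum_mem fun m _ => ?_
      rw [h0, List.prod_eq_zero]
      · exact q.zero_mem
      · exact List.mem_ofFn.2 ⟨i, by simp⟩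
    · have hdeg : ∑ j, deg (Function.update (fun i => L i.succ) i c j) ≤ K := by
        refine le_trans (le_of_eq ?_) hL'
        have : (fun j => deg (Function.update (fun i => L i.succ) i c j)) =
            Function.update (fun i => deg (L i.succ)) i (deg c) := by
          funext j
          by_cases hj : j = i
          · subst hj; simp
          · simp [hj]
        rw [this, Finset.sum_update_of_mem (Finset.mem_univ _), hc, add_assoc,
          ← Finset.add_sum_erase _ _ (Finset.mem_univ i), Finset.sdiff_singleton_eq_erase]
      have := ih _ hdeg
      convert this using 6 with m _ j
      by_cases hj : j = i
      · subst hj; simp [hcA]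
      · simp [hj]

end Filtration

namespace Hecke

variable {ℓ : ℕ}

theorem sigma_mul (w w' : Equiv.Perm (Fin ℓ)) : sigma (w * w') = sigma w * sigma w' := by
  rw [sigma, sigma, sigma, ← map_mul]
  exact (RingQuot.mkAlgHom_rel ℂ (HRel.permMul w w')).symm

theorem sigma_one : sigma (1 : Equiv.Perm (Fin ℓ)) = 1 := by
  rw [sigma, RingQuot.mkAlgHom_rel ℂ HRel.permOne, map_one]

theorem eps_comm (i j : Fin ℓ) : eps i * eps j = eps j * eps i := by
  rw [eps, eps, ← map_mul, ← map_mul]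
  exact RingQuot.mkAlgHom_rel ℂ (HRel.epsComm i j)

theorem sigma_mul_eps (i j : Fin ℓ) (h : (i : ℕ) + 1 < ℓ) :
    sigma (Equiv.swap i ⟨i + 1, h⟩) * eps j =
      eps (Equiv.swap i ⟨i + 1, h⟩ j) * sigma (Equiv.swap i ⟨i + 1, h⟩) -
        ((if j = i then 1 else 0) - (if j = ⟨i + 1, h⟩ then 1 else 0)) := by
  have := RingQuot.mkAlgHom_rel ℂ (HRel.cross i j h)
  rw [map_sub, map_mul, map_mul, ← Algebra.algebraMap_eq_smul_one,
    AlgHom.commutes, map_neg, map_sub] at this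
  rw [sub_eq_iff_eq_add] at this
  refine this.trans ?_
  rw [neg_add_eq_sub]
  congr 2 <;> split_ifs <;> simp

theorem induction_perm {p : Equiv.Perm (Fin ℓ) → Prop} (one : p 1)
    (mul : ∀ w w', p w → p w' → p (w * w'))
    (swap : ∀ (i : Fin ℓ) (h : (i : ℕ) + 1 < ℓ), p (Equiv.swap i ⟨i + 1, h⟩)) (w) : p w := by
  rcases ℓ with _ | ℓ
  · rwa [Subsingleton.elim w 1]
  · have hw : w ∈ Submonoid.closure
        (Set.range fun i : Fin ℓ => Equiv.swap i.castSucc i.succ) := by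
      rw [Equiv.Perm.mclosure_swap_castSucc_succ]; trivial
    induction hw using Submonoid.closure_induction with
    | mem x hx => obtain ⟨i, rfl⟩ := hx; exact swap i.castSucc (by simp)
    | one => exact one
    | mul x y _ _ hx hy => exact mul x y hx hy

theorem sigma_mul_y_of_swap (i m : Fin ℓ) (h : (i : ℕ) + 1 < ℓ) :
    sigma (Equiv.swap i ⟨i + 1, h⟩) * y m =
      y (Equiv.swap i ⟨i + 1, h⟩ m) * sigma (Equiv.swap i ⟨i + 1, h⟩) := by
  set i' : Fin ℓ := ⟨i + 1, h⟩ with hi'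
  set s := Equiv.swap i i' with hs
  have hii : i' ≠ i := fun h => by simpa [hi'] using congrArg Fin.val h
  have hss : sigma s * sigma s = 1 := by
    rw [← sigma_mul, hs, Equiv.swap_mul_self, sigma_one]
  have hval : ∀ j, (s j : ℕ) = if (j : ℕ) = i then (i : ℕ) + 1 else
      if (j : ℕ) = i + 1 then (i : ℕ) else j := fun j => by
    rw [hs, Equiv.swap_apply_def]
    simp only [Fin.ext_iff, hi']
    split_ifs <;> rfl
  have hsum : sigma s * ∑ j with j < m, sigma (Equiv.swap j m) =
      (∑ j with s j < m, sigma (Equiv.swap j (s m))) * sigma s := by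
    rw [Finset.mul_sum, Finset.sum_mul, Finset.sum_filter, Finset.sum_filter,
      ← Equiv.sum_comp s]
    refine Finset.sum_congr rfl fun j _ => ?_
    have : s * Equiv.swap (s j) m = Equiv.swap j (s m) * s := by
      rw [Equiv.mul_swap_eq_swap_mul, hs, Equiv.swap_apply_self]
    rw [← sigma_mul, ← sigma_mul, this]
  rw [y, y, mul_sub, hsum, sigma_mul_eps, ← hi', ← hs, sub_mul, sub_right_comm]
  rw [sub_sub, sub_right_inj]
  rcases eq_or_ne m i with rfl | hmi
  · have h1 : (Finset.univ.filter fun j => j < s m) =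
        insert m (Finset.univ.filter fun j => s j < m) := by
      ext j
      simp only [Finset.mem_insert, Finset.mem_filter, Finset.mem_univ, true_and, Fin.lt_def,
        Fin.ext_iff, hval]
      split_ifs <;> omega
    rw [h1, Finset.sum_insert (by
      simp only [Finset.mem_filter, Finset.mem_univ, true_and, Fin.lt_def, hval]
      split_ifs <;> omega), add_mul]
    have : Equiv.swap m (s m) = s := by simp [hs]
    rw [this, hss]
    simp [hii.symm, add_comm]
  rcases eq_or_ne m i' with rfl | hmi'
  · have h1 : (Finset.univ.filter fun j => s j < i') =
        insert i' (Finset.univ.filter fun j => j < s i') := by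
      ext j
      simp only [Finset.mem_insert, Finset.mem_filter, Finset.mem_univ, true_and, Fin.lt_def,
        Fin.ext_iff, hval, hi']
      split_ifs <;> omega
    rw [h1, Finset.sum_insert (by
      simp only [Finset.mem_filter, Finset.mem_univ, true_and, Fin.lt_def, hval, hi']
      split_ifs <;> omega), add_mul]
    have : Equiv.swap i' (s i') = s := by simp [hs, Equiv.swap_comm]
    rw [this, hss]
    simp [hii]
  · have h1 : (Finset.univ.filter fun j => s j < m) = Finset.univ.filter fun j => j < s m := by
      have hm1 := Fin.val_ne_of_ne hmi
      have hm2 := Fin.val_ne_of_ne hmi'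
      ext j
      simp only [Finset.mem_filter, Finset.mem_univ, true_and, Fin.lt_def, hval, hi'] at *
      split_ifs <;> omega
    rw [h1]
    simp [hmi, hmi']

theorem sigma_mul_y (w : Equiv.Perm (Fin ℓ)) (m : Fin ℓ) :
    sigma w * y m = y (w m) * sigma w := by
  induction w using induction_perm generalizing m with
  | one => simp [sigma_one]
  | mul w w' hw hw' =>
    rw [sigma_mul, mul_assoc, hw', ← mul_assoc, hw, mul_assoc, Equiv.Perm.mul_apply]
  | swap i h => exact sigma_mul_y_of_swap i m h

theorem sigma_mul_y_pow (w : Equiv.Perm (Fin ℓ)) (m : Fin ℓ) (d : ℕ) :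
    sigma w * y m ^ d = y (w m) ^ d * sigma w :=
  SemiconjBy.pow_right (sigma_mul_y w m) d

theorem sigma_mul_list_prod {r : ℕ} (w : Equiv.Perm (Fin ℓ)) (m : Fin r → Fin ℓ)
    (d : Fin r → ℕ) :
    sigma w * (List.ofFn fun i => y (m i) ^ d i).prod =
      (List.ofFn fun i => y (w (m i)) ^ d i).prod * sigma w := by
  induction r with
  | zero => simp
  | succ r ih =>
    rw [List.ofFn_succ, List.ofFn_succ, List.prod_cons, List.prod_cons, ← mul_assoc,
      sigma_mul_y_pow, mul_assoc, ih (fun i => m i.succ), mul_assoc]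

theorem y_commutator {i j : Fin ℓ} (hij : i ≠ j) :
    y i * y j - y j * y i = (y j - y i) * sigma (Equiv.swap i j) := by
  obtain ⟨ℓ, rfl⟩ : ∃ k, ℓ = k + 2 := ⟨ℓ - 2, by
    have := Fin.val_ne_of_ne hij; omega⟩
  have base : (y 0 * y 1 - y 1 * y 0 : Hecke (ℓ + 2)) =
      (y 1 - y 0) * sigma (Equiv.swap 0 1) := by
    have hc := sigma_mul_eps (0 : Fin (ℓ + 2)) 0 (by simp)
    have h1 : (⟨((0 : Fin (ℓ + 2)) : ℕ) + 1, by simp⟩ : Fin (ℓ + 2)) = 1 := rfl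
    rw [h1] at hc
    have hss : sigma (Equiv.swap 0 1) * sigma (Equiv.swap 0 1) = (1 : Hecke (ℓ + 2)) := by
      rw [← sigma_mul, Equiv.swap_mul_self, sigma_one]
    have hy0 : (y 0 : Hecke (ℓ + 2)) = eps 0 := by
      simp [y]
    have hy1 : (y 1 : Hecke (ℓ + 2)) = eps 1 - sigma (Equiv.swap 0 1) := by
      have : (Finset.univ.filter fun j : Fin (ℓ + 2) => j < 1) = {0} := by
        ext j; simp
      rw [y, this, Finset.sum_singleton]
    simp only [Equiv.swap_apply_left, if_true, zero_ne_one, if_false, sub_zero] at hc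
    rw [hy0, hy1, mul_sub, sub_mul, hc, eps_comm 0 1, sub_mul, sub_mul, hss]
    abel
  obtain ⟨w, rfl, rfl⟩ : ∃ w : Equiv.Perm (Fin (ℓ + 2)), w 0 = i ∧ w 1 = j := by
    refine ⟨Equiv.swap 0 i * Equiv.swap 1 (Equiv.swap 0 i j), ?_, by simp⟩
    have : (0 : Fin (ℓ + 2)) ≠ Equiv.swap 0 i j := fun h => hij <| by
      exact (Equiv.swap 0 i).injective ((Equiv.swap_apply_right 0 i).trans h)
    rw [Equiv.Perm.mul_apply, Equiv.swap_apply_of_ne_of_ne (by simp) this,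
      Equiv.swap_apply_left]
  have hya : ∀ m x, sigma w * (y m * x) = y (w m) * (sigma w * x) := fun m x => by
    rw [← mul_assoc, sigma_mul_y, mul_assoc]
  have hbase := congrArg (fun x => sigma w * x * sigma w⁻¹) base
  have hsw : Equiv.swap (w 0) (w 1) * w = w * Equiv.swap 0 1 := by
    rw [Equiv.mul_swap_eq_swap_mul]
  simp only [mul_sub, ← mul_assoc, sigma_mul_y, sub_mul] at hbase
  simp only [mul_assoc, hya, ← sigma_mul w, ← hsw] at hbase
  rw [sigma_mul (Equiv.swap _ _)] at hbase
  simpa only [mul_assoc, ← sigma_mul w, mul_inv_cancel, sigma_one, mul_one, ← sub_mul]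
    using hbase

/-- A subspace stable under `W_ℓ` and under all `y_m` is an `H_ℓ`-submodule. -/
theorem hStable_of_sigma_y {M : Type} [AddCommGroup M] [Module ℂ M]
    (ρ : Hecke ℓ →ₐ[ℂ] Module.End ℂ M) (p : Submodule ℂ M)
    (hσ : ∀ w, ∀ x ∈ p, ρ (sigma w) x ∈ p) (hy : ∀ m, ∀ x ∈ p, ρ (y m) x ∈ p) :
    HStable ρ p := by
  intro h
  obtain ⟨a, rfl⟩ := RingQuot.mkAlgHom_surjective ℂ (HRel ℓ) h
  induction a using FreeAlgebra.induction with
  | grade0 r =>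
    intro x hx
    rw [AlgHom.commutes, AlgHom.commutes]
    exact p.smul_mem r hx
  | grade1 g =>
    intro x hx
    cases g with
    | perm w => exact hσ w x hx
    | eps m =>
      change ρ (eps m) x ∈ p
      rw [← sub_add_cancel (eps m) (∑ j with j < m, sigma (Equiv.swap j m)), map_add, map_sum,
        LinearMap.add_apply, LinearMap.sum_apply]
      exact p.add_mem (hy m x hx) (p.sum_mem fun j _ => hσ _ x hx)
  | mul a b ha hb =>
    intro x hx
    rw [map_mul, map_mul]
    exact ha _ (hb x hx)
  | add a b ha hb =>
    intro x hx
    rw [map_add, map_add]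
    exact p.add_mem (ha x hx) (hb x hx)

end Hecke

section DegreeFiltration

variable {ℓ : ℕ} {M : Type} [AddCommGroup M] [Module ℂ M]

/-- The filtration of `M` whose `k`-th piece is spanned by the products of fewer than `k` of the
`y_m`, applied to `U`. -/
def degFilt (ρ : Hecke ℓ →ₐ[ℂ] Module.End ℂ M) (U : Submodule ℂ M) : ℕ → Submodule ℂ M
  | 0 => ⊥
  | k + 1 => U ⊔ ⨆ m, (degFilt ρ U k).map (ρ (Hecke.y m))

variable (ρ : Hecke ℓ →ₐ[ℂ] Module.End ℂ M) (U : Submodule ℂ M)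

theorem degFilt_one : degFilt ρ U 1 = U := by
  simp [degFilt]

theorem degFilt_le_succ (k : ℕ) : degFilt ρ U k ≤ degFilt ρ U (k + 1) := by
  induction k with
  | zero => exact bot_le
  | succ k ih => exact sup_le_sup_left (iSup_mono fun m => Submodule.map_mono ih) _

theorem degFilt_mono : Monotone (degFilt ρ U) := monotone_nat_of_le_succ (degFilt_le_succ ρ U)

theorem raisesBy_y (m : Fin ℓ) : RaisesBy (degFilt ρ U) (ρ (Hecke.y m)) 1 := fun k _ hx =>
  (le_iSup (fun m => (degFilt ρ U k).map (ρ (Hecke.y m))) m |>.trans le_sup_right)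
    (Submodule.mem_map_of_mem hx)

variable {U}

theorem raisesBy_sigma (hU : ∀ w, ∀ x ∈ U, ρ (Hecke.sigma w) x ∈ U)
    (w : Equiv.Perm (Fin ℓ)) : RaisesBy (degFilt ρ U) (ρ (Hecke.sigma w)) 0 := by
  intro k
  change degFilt ρ U k ≤ (degFilt ρ U k).comap (ρ (Hecke.sigma w))
  induction k with
  | zero => exact bot_le
  | succ k ih =>
    refine sup_le (fun x hx => Submodule.mem_sup_left (hU w x hx)) (iSup_le fun m => ?_)
    rintro _ ⟨x, hx, rfl⟩
    rw [Submodule.mem_comap, ← Module.End.mul_apply, ← map_mul, Hecke.sigma_mul_y, map_mul]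
    exact raisesBy_y ρ U (w m) k _ (ih hx)

theorem raisesBy_y_pow (m : Fin ℓ) (d : ℕ) :
    RaisesBy (degFilt ρ U) (ρ (Hecke.y m ^ d)) d := by
  simpa using (raisesBy_y ρ U m).pow d

theorem raisesLt_y_commutator (hU : ∀ w, ∀ x ∈ U, ρ (Hecke.sigma w) x ∈ U)
    {i j : Fin ℓ} (hij : i ≠ j) (d e : ℕ) :
    RaisesLt (degFilt ρ U) (ρ (Hecke.y i ^ d) * ρ (Hecke.y j ^ e) -
      ρ (Hecke.y j ^ e) * ρ (Hecke.y i ^ d)) (d + e) := by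
  have h : RaisesLt (degFilt ρ U) (ρ (Hecke.y i) * ρ (Hecke.y j) -
      ρ (Hecke.y j) * ρ (Hecke.y i)) (1 + 1) := by
    rw [← map_mul, ← map_mul, ← map_sub, Hecke.y_commutator hij, map_mul, map_sub]
    exact (((raisesBy_y ρ U j).sub (raisesBy_y ρ U i)).mul (raisesBy_sigma ρ hU _)).raisesLt
  simpa using h.pow_commutator_pow (raisesBy_y ρ U i) (raisesBy_y ρ U j) d e

theorem iSup_degFilt_eq_top (hU : ∀ w, ∀ x ∈ U, ρ (Hecke.sigma w) x ∈ U)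
    (hgen : ∀ p : Submodule ℂ M, HStable ρ p → U ≤ p → p = ⊤) :
    ⨆ k, degFilt ρ U k = ⊤ := by
  refine hgen _ (Hecke.hStable_of_sigma_y ρ _ (fun w => ?_) fun m => ?_)
    (le_iSup_of_le 1 (degFilt_one ρ U).ge)
  · change _ ≤ Submodule.comap (ρ (Hecke.sigma w)) (⨆ k, degFilt ρ U k)
    exact iSup_le fun k x hx => Submodule.mem_iSup_of_mem k (raisesBy_sigma ρ hU w k x hx)
  · change _ ≤ Submodule.comap (ρ (Hecke.y m)) (⨆ k, degFilt ρ U k)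
    exact iSup_le fun k x hx => Submodule.mem_iSup_of_mem (k + 1) (raisesBy_y ρ U m k x hx)

/-- Ordered monomials in the `y_m` of degree `k` span the degree `k` part of `M`,
up to lower order terms. -/
theorem degFilt_succ_le (hU : ∀ w, ∀ x ∈ U, ρ (Hecke.sigma w) x ∈ U) (k : ℕ) :
    degFilt ρ U (k + 1) ≤ degFilt ρ U k ⊔
      ⨆ (d : Fin ℓ → ℕ) (_ : ∑ i, d i = k),
        U.map (ρ (List.ofFn fun i => Hecke.y i ^ d i).prod) := by
  induction k with
  | zero =>
    rw [degFilt_one]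
    refine le_sup_of_le_right (le_iSup₂_of_le 0 (by simp) ?_)
    simp [List.ofFn_const, Module.End.one_eq_id]
  | succ k ih =>
    rw [degFilt]
    refine sup_le (le_sup_of_le_left le_sup_left) (iSup_le fun m => ?_)
    refine (Submodule.map_mono ih).trans ?_
    rw [Submodule.map_sup]
    refine sup_le (le_sup_of_le_left ?_) ?_
    · rintro _ ⟨x, hx, rfl⟩
      exact raisesBy_y ρ U m k x hx
    rw [Submodule.map_le_iff_le_comap]
    refine iSup₂_le fun d hd => ?_
    rintro _ ⟨u, hu, rfl⟩
    rw [Submodule.mem_comap]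
    have h := RaisesLt.mul_list_prod_sub (G := degFilt ρ U) (T := ρ (Hecke.y m)) (d := 1)
      (b := fun i => ρ (Hecke.y i ^ d i)) (e := d) (fun j => raisesBy_y_pow ρ j (d j)) m
      (fun j hj => by simpa using raisesLt_y_commutator ρ hU hj.symm 1 (d j)) 0 u
      (by rwa [zero_add, degFilt_one])
    rw [zero_add, hd, add_comm 1, LinearMap.sub_apply] at h
    have h1 : (List.ofFn fun i => ρ (Hecke.y i ^ d i)).prod =
        ρ (List.ofFn fun i => Hecke.y i ^ d i).prod := by
      rw [map_list_prod, List.map_ofFn]; rfl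
    have h2 : (List.ofFn (Function.update (fun i => ρ (Hecke.y i ^ d i)) m
        (ρ (Hecke.y m) * ρ (Hecke.y m ^ d m)))).prod =
        ρ (List.ofFn fun i => Hecke.y i ^ Function.update d m (d m + 1) i).prod := by
      rw [map_list_prod, List.map_ofFn]
      congr 2
      funext j
      by_cases hj : j = m
      · subst hj; simp [pow_succ']
      · simp [hj]
    rw [h1, h2] at h
    rw [← sub_add_cancel (ρ (Hecke.y m) _) (ρ (List.ofFn fun i =>
      Hecke.y i ^ Function.update d m (d m + 1) i).prod u)]
    refine Submodule.add_mem_sup h (Submodule.mem_iSup_of_mem (Function.update d m (d m + 1))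
      (Submodule.mem_iSup_of_mem ?_ (Submodule.mem_map_of_mem hu)))
    rw [Finset.sum_update_of_mem (Finset.mem_univ _), ← hd,
      ← Finset.add_sum_erase _ _ (Finset.mem_univ m), Finset.sdiff_singleton_eq_erase]
    ring

end DegreeFiltration

section DrinfeldFunctor

variable {ℓ n : ℕ} {M : Type} [AddCommGroup M] [Module ℂ M]

/-- The operator `τ_m(E_{ab})` at a letter `(d, a, b)`, with coefficient `y_m ^ d`. -/
def letterOp (ρ : Hecke ℓ →ₐ[ℂ] Module.End ℂ M) (a : ℕ × Fin n × Fin n) (m : Fin ℓ) :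
    Module.End ℂ (MW ℓ n M) :=
  hOp n ρ (Hecke.y m ^ a.1) * tauOp m a.2.1 a.2.2

variable (ρ : Hecke ℓ →ₐ[ℂ] Module.End ℂ M)

theorem letterOp_apply (a : ℕ × Fin n × Fin n) (m : Fin ℓ) (f : MW ℓ n M) (u : Word ℓ n) :
    letterOp ρ a m f u = if u m = a.2.1 then
      ρ (Hecke.y m ^ a.1) (f (Function.update u m a.2.2)) else 0 := by
  change ρ (Hecke.y m ^ a.1) (if u m = a.2.1 then f (Function.update u m a.2.2) else 0) = _
  rw [apply_ite (ρ (Hecke.y m ^ a.1)), map_zero]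

theorem letterOp_mul (a b : ℕ × Fin n × Fin n) :
    (∀ m, letterOp ρ a m * letterOp ρ b m = 0) ∨
      ∃ c : ℕ × Fin n × Fin n, c.1 = a.1 + b.1 ∧
        ∀ m, letterOp ρ a m * letterOp ρ b m = letterOp ρ c m := by
  by_cases h : a.2.2 = b.2.1
  · refine .inr ⟨(a.1 + b.1, a.2.1, b.2.2), rfl, fun m => LinearMap.ext fun f => ?_⟩
    funext u
    simp [letterOp_apply, h, pow_add]
  · refine .inl fun m => LinearMap.ext fun f => ?_
    funext u
    simp [letterOp_apply, h]

theorem letterOp_list_prod_apply {r : ℕ} (d : Fin r → ℕ) (v w : Fin r → Fin n)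
    (m : Fin r → Fin ℓ) (hm : Function.Injective m) (f : MW ℓ n M) (u : Word ℓ n) :
    (List.ofFn fun i => letterOp ρ (d i, v i, w i) (m i)).prod f u =
      if ∀ i, u (m i) = v i then
        ρ (List.ofFn fun i => Hecke.y (m i) ^ d i).prod (f (Function.extend m w u)) else 0 := by
  induction r generalizing u with
  | zero =>
    have : Function.extend m w u = u := by
      funext p
      exact Function.extend_apply' _ _ _ fun ⟨i, _⟩ => i.elim0
    simp [this]
  | succ r ih =>
    rw [List.ofFn_succ, List.prod_cons, Module.End.mul_apply, letterOp_apply,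
      ih (fun i => d i.succ) (fun i => v i.succ) (fun i => w i.succ) (fun i => m i.succ)
        (fun i j h => Fin.succ_injective _ (hm h))]
    have hne : ∀ i : Fin r, m i.succ ≠ m 0 := fun i h => Fin.succ_ne_zero i (hm h)
    have hext : Function.extend (fun i : Fin r => m i.succ) (fun i => w i.succ)
        (Function.update u (m 0) (w 0)) = Function.extend m w u := by
      funext p
      by_cases hp : ∃ i, m i = p
      · obtain ⟨i, rfl⟩ := hp
        rw [hm.extend_apply]
        refine Fin.cases ?_ (fun i => ?_) i
        · rw [Function.extend_apply' _ _ _ (fun ⟨i, hi⟩ => hne i hi), Function.update_self]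
        · exact Function.Injective.extend_apply (f := fun i : Fin r => m i.succ)
            (fun i j h => Fin.succ_injective _ (hm h)) _ _ i
      · rw [Function.extend_apply' _ _ _ hp, Function.extend_apply' _ _ _
          (fun ⟨i, hi⟩ => hp ⟨_, hi⟩), Function.update_of_ne]
        exact fun h => hp ⟨0, h.symm⟩
    simp only [hext, Function.update_of_ne (hne _), Fin.forall_fin_succ, List.ofFn_succ,
      List.prod_cons, map_mul, Module.End.mul_apply]
    by_cases h0 : u (m 0) = v 0
    · by_cases h1 : ∀ i : Fin r, u (m i.succ) = v i.succ <;> simp [h0, h1]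
    · simp [h0]

/-- The filtration of `M ⊗ (ℂ^n)^{⊗ℓ}` induced by the degree filtration of `M`. -/
def wordFilt (n : ℕ) (U : Submodule ℂ M) (k : ℕ) : Submodule ℂ (MW ℓ n M) :=
  Submodule.pi Set.univ fun _ => degFilt ρ U k

variable {U : Submodule ℂ M}

theorem mem_wordFilt {k : ℕ} {f : MW ℓ n M} :
    f ∈ wordFilt ρ n U k ↔ ∀ w, f w ∈ degFilt ρ U k := by
  simp [wordFilt, Submodule.mem_pi]

theorem raisesBy_letterOp (a : ℕ × Fin n × Fin n) (m : Fin ℓ) :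
    RaisesBy (wordFilt ρ n U) (letterOp ρ a m) a.1 := by
  intro k f hf
  rw [mem_wordFilt] at hf ⊢
  intro u
  rw [letterOp_apply]
  split_ifs
  · exact raisesBy_y_pow ρ m a.1 k _ (hf _)
  · exact Submodule.zero_mem _

theorem raisesLt_letterOp_commutator (hU : ∀ w, ∀ x ∈ U, ρ (Hecke.sigma w) x ∈ U)
    (a b : ℕ × Fin n × Fin n) {i j : Fin ℓ} (hij : i ≠ j) :
    RaisesLt (wordFilt ρ n U)
      (letterOp ρ a i * letterOp ρ b j - letterOp ρ b j * letterOp ρ a i) (a.1 + b.1) := by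
  intro k f hf
  rw [mem_wordFilt] at hf ⊢
  intro u
  have h := raisesLt_y_commutator ρ hU hij a.1 b.1 k _
    (hf (Function.update (Function.update u i a.2.2) j b.2.2))
  simp only [LinearMap.sub_apply, Pi.sub_apply, Module.End.mul_apply, letterOp_apply,
    Function.update_of_ne hij, Function.update_of_ne hij.symm,
    Function.update_comm hij.symm b.2.2 a.2.2 u] at h ⊢
  by_cases h1 : u i = a.2.1 <;> by_cases h2 : u j = b.2.1 <;> simp [h1, h2]
  simpa using h

/-- The action of `σ ∈ W_ℓ` on `M ⊗ (ℂ^n)^{⊗ℓ}`. -/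
def weylOp (n : ℕ) (σ : Equiv.Perm (Fin ℓ)) : Module.End ℂ (MW ℓ n M) :=
  hOp n ρ (Hecke.sigma σ) * permOp n σ

theorem weylOp_apply (σ : Equiv.Perm (Fin ℓ)) (f : MW ℓ n M) (u : Word ℓ n) :
    weylOp ρ n σ f u = ρ (Hecke.sigma σ) (f (u ∘ σ)) := rfl

theorem weylOp_mul (σ τ : Equiv.Perm (Fin ℓ)) :
    weylOp ρ n (σ * τ) = weylOp ρ n σ * weylOp ρ n τ := by
  refine LinearMap.ext fun f => funext fun u => ?_
  rw [Module.End.mul_apply, weylOp_apply, weylOp_apply, weylOp_apply, Hecke.sigma_mul, map_mul]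
  rfl

/-- The sign of a permutation, as a complex number. -/
def csign (σ : Equiv.Perm (Fin ℓ)) : ℂ := ((Equiv.Perm.sign σ : ℤ) : ℂ)

theorem csign_mul (σ τ : Equiv.Perm (Fin ℓ)) : csign (σ * τ) = csign σ * csign τ := by
  simp [csign]

theorem csign_mul_self (σ : Equiv.Perm (Fin ℓ)) : csign σ * csign σ = 1 := by
  rw [csign, ← Int.cast_mul, ← Units.val_mul, Int.units_mul_self]
  simp

theorem csign_smul_weylOp_sub_mem (σ : Equiv.Perm (Fin ℓ)) (f : MW ℓ n M) :
    csign σ • weylOp ρ n σ f - f ∈ NSub n ρ := by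
  induction σ using Hecke.induction_perm generalizing f with
  | one =>
    have : weylOp ρ n 1 f = f := by
      funext u
      rw [weylOp_apply, Hecke.sigma_one, map_one]
      rfl
    simp [this, csign]
  | mul σ τ hσ hτ =>
    have := (NSub n ρ).add_mem (hσ (csign τ • weylOp ρ n τ f)) (hτ f)
    rwa [sub_add_sub_cancel, map_smul, smul_smul, ← csign_mul, ← Module.End.mul_apply,
      ← weylOp_mul] at this
  | swap i h =>
    have hs : csign (Equiv.swap i ⟨i + 1, h⟩) = -1 := by
      rw [csign, Equiv.Perm.sign_swap]
      · simp
      · exact fun h => by simpa using congrArg Fin.val h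
    rw [hs, neg_one_smul, ← neg_add']
    exact (NSub n ρ).neg_mem (Submodule.mem_iSup_of_mem i
      (Submodule.mem_iSup_of_mem h ⟨f, rfl⟩))

/-- The antisymmetrization of an element of `M ⊗ (ℂ^n)^{⊗ℓ}`. -/
def antisymmetrize (f : MW ℓ n M) : MW ℓ n M := ∑ σ, csign σ • weylOp ρ n σ f

theorem antisymmetrize_sub_mem (f : MW ℓ n M) :
    antisymmetrize ρ f - (ℓ.factorial : ℂ) • f ∈ NSub n ρ := by
  have := (NSub n ρ).sum_mem (t := Finset.univ) fun σ _ => csign_smul_weylOp_sub_mem ρ σ f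
  rwa [Finset.sum_sub_distrib, Finset.sum_const, Finset.card_univ, Fintype.card_perm,
    Fintype.card_fin, ← Nat.cast_smul_eq_nsmul ℂ] at this

theorem weylOp_antisymmetrize (σ : Equiv.Perm (Fin ℓ)) (f : MW ℓ n M) :
    weylOp ρ n σ (antisymmetrize ρ f) = csign σ • antisymmetrize ρ f := by
  rw [antisymmetrize, map_sum, Finset.smul_sum, ← Equiv.sum_comp (Equiv.mulLeft σ) (fun τ =>
    csign σ • csign τ • weylOp ρ n τ f)]
  refine Finset.sum_congr rfl fun τ _ => ?_
  rw [map_smul, Equiv.coe_mulLeft, csign_mul, weylOp_mul, smul_smul, ← mul_assoc, csign_mul_self,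
    one_mul, Module.End.mul_apply]

/-- The sum of the letter products over all placements of `ℓ` letters maps an antisymmetric
element to an antisymmetrization of a pure tensor. -/
theorem sum_letterOp_list_prod_antisymmetrize (g : MW ℓ n M)
    (hg : ∀ σ, weylOp ρ n σ g = csign σ • g) (d : Fin ℓ → ℕ) (v w : Word ℓ n) :
    ∑ m : Fin ℓ → Fin ℓ with Function.Injective m,
        (List.ofFn fun i => letterOp ρ (d i, v i, w i) (m i)).prod g =
      antisymmetrize ρ (Pi.single v (ρ (List.ofFn fun i => Hecke.y i ^ d i).prod (g w))) := by
  symm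
  refine Finset.sum_bij (fun σ _ => ⇑σ) (fun σ _ => by simpa using σ.injective)
    (fun σ _ τ _ h => DFunLike.coe_injective h) (fun m hm => ?_) (fun σ _ => funext fun u => ?_)
  · have hm' := (Finset.mem_filter.1 hm).2
    exact ⟨Equiv.ofBijective m (Finite.injective_iff_bijective.1 hm'), Finset.mem_univ _, rfl⟩
  · rw [letterOp_list_prod_apply ρ d v w σ σ.injective, Pi.smul_apply, weylOp_apply]
    by_cases huv : u ∘ σ = v
    · have hext : Function.extend σ w u = w ∘ ⇑σ⁻¹ := by
        funext p
        obtain ⟨i, rfl⟩ := σ.surjective p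
        rw [σ.injective.extend_apply]
        simp
      have hgw : ρ (Hecke.sigma σ) (g w) = csign σ • g (w ∘ ⇑σ⁻¹) := by
        have := congrFun (hg σ) (w ∘ ⇑σ⁻¹)
        rw [weylOp_apply] at this
        rw [show (w ∘ ⇑σ⁻¹) ∘ ⇑σ = w by funext i; simp] at this
        exact this
      rw [huv, Pi.single_eq_same, if_pos (show ∀ i, u (σ i) = v i from congrFun huv), hext,
        ← Module.End.mul_apply, ← map_mul, Hecke.sigma_mul_list_prod, map_mul,
        Module.End.mul_apply, hgw, map_smul, smul_smul, csign_mul_self, one_smul]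
    · rw [Pi.single_eq_of_ne huv, map_zero, smul_zero, if_neg (show ¬ ∀ i, u (σ i) = v i from fun h => huv (funext h))]

/-- A stable subspace containing a nonzero antisymmetric element with values in a simple
`W_ℓ`-module `U` generating `M` is everything. -/
theorem eq_top_of_antisymm_mem (hU : ∀ w, ∀ x ∈ U, ρ (Hecke.sigma w) x ∈ U)
    (hsimple : ∀ p : Submodule ℂ M, p ≤ U →
      (∀ (w : Equiv.Perm (Fin ℓ)) (x : M), x ∈ p → ρ (Hecke.sigma w) x ∈ p) → p = ⊥ ∨ p = U)
    (hgen : ∀ p : Submodule ℂ M, HStable ρ p → U ≤ p → p = ⊤)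
    (q : Submodule ℂ (MW ℓ n M)) (hN : NSub n ρ ≤ q)
    (hq : ∀ a b d, ∀ f ∈ q, sumOp n ρ a b d f ∈ q)
    (g : MW ℓ n M) (hgq : g ∈ q) (hgU : ∀ w, g w ∈ U) (hg0 : g ≠ 0)
    (hg : ∀ σ, weylOp ρ n σ g = csign σ • g) : q = ⊤ := by
  have hspan : Submodule.span ℂ (Set.range g) = U := by
    refine (hsimple _ (Submodule.span_le.2 (Set.range_subset_iff.2 hgU)) ?_).resolve_left ?_
    · intro σ
      change _ ≤ (Submodule.span ℂ (Set.range g)).comap (ρ (Hecke.sigma σ))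
      rw [Submodule.span_le]
      rintro _ ⟨w, rfl⟩
      have := congrFun (hg σ) (w ∘ ⇑σ⁻¹)
      rw [weylOp_apply, show (w ∘ ⇑σ⁻¹) ∘ ⇑σ = w by funext i; simp] at this
      change ρ (Hecke.sigma σ) (g w) ∈ Submodule.span ℂ (Set.range g)
      rw [this]
      exact Submodule.smul_mem _ _ (Submodule.subset_span ⟨_, rfl⟩)
    · intro h
      exact hg0 (funext fun w => Submodule.span_eq_bot.1 h _ ⟨w, rfl⟩)
  have hfilt : ∀ k, ∀ v : Word ℓ n, degFilt ρ U k ≤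
      q.comap (LinearMap.single ℂ (fun _ => M) v) := by
    intro k
    induction k with
    | zero => exact fun v => bot_le
    | succ k ih =>
      intro v
      refine (degFilt_succ_le ρ hU k).trans (sup_le (ih v) (iSup₂_le fun d hd => ?_))
      rw [Submodule.map_le_iff_le_comap, ← hspan, Submodule.span_le]
      rintro _ ⟨w, rfl⟩
      have hG : ∀ j ≤ k, wordFilt ρ n U j ≤ q := fun j hj f hf => by
        rw [← Finset.univ_sum_single f]
        exact q.sum_mem fun v _ => ih v (degFilt_mono ρ U hj ((mem_wordFilt ρ).1 hf v))
      have hmem := sum_injective_list_prod_mem (fun a : ℕ × Fin n × Fin n => a.1) (letterOp ρ)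
        (fun a m => raisesBy_letterOp ρ a m)
        (fun a b m m' h => raisesLt_letterOp_commutator ρ hU a b h) (letterOp_mul ρ) q
        (fun a f hf => hq a.2.1 a.2.2 a.1 f hf) k hG g hgq
        ((mem_wordFilt ρ).2 fun w => by rw [degFilt_one]; exact hgU w)
        (fun i => (d i, v i, w i)) hd.le
      rw [sum_letterOp_list_prod_antisymmetrize ρ g hg d v w] at hmem
      have := q.sub_mem hmem (hN (antisymmetrize_sub_mem ρ
        (Pi.single v (ρ (List.ofFn fun i => Hecke.y i ^ d i).prod (g w)))))
      rw [sub_sub_cancel] at this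
      exact (q.smul_mem_iff (Nat.cast_ne_zero.2 ℓ.factorial_ne_zero)).1 this
  refine eq_top_iff.2 fun f _ => ?_
  rw [← Finset.univ_sum_single f]
  refine q.sum_mem fun v _ => ?_
  have : f v ∈ ⨆ k, degFilt ρ U k := by
    rw [iSup_degFilt_eq_top ρ hU hgen]; trivial
  exact iSup_le (fun k => hfilt k v) this

end DrinfeldFunctor

/-- Let `M` be an `H_ℓ`-module and `U ⊆ M` a `ℂ[W_ℓ]`-submodule which is
simple as a `ℂ[W_ℓ]`-module and generates `M` over `H_ℓ`. If `D_ℓ(U) ≠ 0` (where `D_ℓ(U)`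
is the image of `U ⊗ (ℂ^n)^{⊗ℓ}` in `D_ℓ(M)`), then `D_ℓ(U)` generates `D_ℓ(M)` over
`Y(gl_n)`. -/
theorem statement4 (n ℓ : ℕ) (hn : 0 < n) (hℓ : 0 < ℓ)
    (M : Type) [AddCommGroup M] [Module ℂ M]
    (ρ : Hecke ℓ →ₐ[ℂ] Module.End ℂ M)
    (U : Submodule ℂ M)
    -- `U` is a `ℂ[W_ℓ]`-submodule:
    (hWstable : ∀ (w : Equiv.Perm (Fin ℓ)) (x : M), x ∈ U → ρ (Hecke.sigma w) x ∈ U)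
    -- `U` is simple as a `ℂ[W_ℓ]`-module:
    (hUne : U ≠ ⊥)
    (hUsimple : ∀ p : Submodule ℂ M, p ≤ U →
      (∀ (w : Equiv.Perm (Fin ℓ)) (x : M), x ∈ p → ρ (Hecke.sigma w) x ∈ p) →
      p = ⊥ ∨ p = U)
    -- `U` generates `M` over `H_ℓ`:
    (hgen : ∀ p : Submodule ℂ M, HStable ρ p → U ≤ p → p = ⊤)
    (π : Yangian n →ₐ[ℂ] Module.End ℂ (Dmod n ρ))
    (hπ : IsDrinfeldAction n ρ π)
    -- `D_ℓ(U) ≠ 0`: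
    (hDU : (Submodule.pi Set.univ (fun _ : Word ℓ n => U)).map (NSub n ρ).mkQ ≠ ⊥) :
    ∀ q : Submodule ℂ (Dmod n ρ), YStable π q →
      (Submodule.pi Set.univ (fun _ : Word ℓ n => U)).map (NSub n ρ).mkQ ≤ q → q = ⊤ := by
  intro q hq hle
  suffices h : q.comap (NSub n ρ).mkQ = ⊤ by
    refine eq_top_iff.2 fun x _ => ?_
    obtain ⟨f, rfl⟩ := (NSub n ρ).mkQ_surjective x
    exact (h ▸ Submodule.mem_top : f ∈ q.comap (NSub n ρ).mkQ)
  obtain ⟨f, hfU, hfN⟩ : ∃ f ∈ Submodule.pi Set.univ (fun _ : Word ℓ n => U), f ∉ NSub n ρ := by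
    by_contra! h
    refine hDU (eq_bot_iff.2 ?_)
    rintro _ ⟨f, hf, rfl⟩
    exact (Submodule.mem_bot ℂ).2 ((Submodule.Quotient.mk_eq_zero _).2 (h f hf))
  have hgU : ∀ w, antisymmetrize ρ f w ∈ U := fun w => by
    rw [antisymmetrize, Finset.sum_apply]
    exact U.sum_mem fun σ _ => U.smul_mem _ (hWstable σ _ (hfU _ trivial))
  refine eq_top_of_antisymm_mem ρ hWstable hUsimple hgen _ ?_ ?_ (antisymmetrize ρ f) ?_ hgU ?_
    (fun σ => weylOp_antisymmetrize ρ σ f)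
  · intro x hx
    rw [Submodule.mem_comap, Submodule.mkQ_apply, (Submodule.Quotient.mk_eq_zero _).2 hx]
    exact q.zero_mem
  · intro a b d x hx
    have := hq (Yangian.t a b d) _ hx
    rwa [Submodule.mkQ_apply, hπ] at this
  · exact hle (Submodule.mem_map_of_mem fun w _ => hgU w)
  · intro h0
    have := antisymmetrize_sub_mem ρ f
    rw [h0, zero_sub, neg_mem_iff] at this
    exact hfN (((NSub n ρ).smul_mem_iff (Nat.cast_ne_zero.2 ℓ.factorial_ne_zero)).1 this)
end
end

section
/- Let λ, μ ∈ ℂ^r both be dominant and let w, w′ ∈ W_r be such that w·μ and w′·μ both lie in S^{(n)}(λ;ℓ). For ν ∈ S^{(n)}(λ;ℓ) and 1 ≤ k ≤ n−1, define the Drinfeld polynomial Q_{λ,ν;k}(u) := ∏_{i : λ_i − ν_i = k} (u − λ_i) ∈ ℂ[u]. Then Q_{λ,w·μ;k} = Q_{λ,w′·μ;k} for all k = 1,…,n−1 if and only if W_λ w W_μ = W_λ w′ W_μ, where W_λ and W_μ are the stabilizers of λ and μ in W_r. -/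
set_option synthInstance.maxHeartbeats 1000000
set_option maxHeartbeats 1000000

noncomputable section

open Polynomial

open scoped Classical in
/-- The Drinfeld polynomial `Q_{λ,ν;k}(u) := ∏_{i : λ_i − ν_i = k} (u − λ_i)`. -/
def drinfeldPoly {r : ℕ} (lam ν : Fin r → ℂ) (k : ℕ) : Polynomial ℂ :=
  ∏ i ∈ Finset.univ.filter (fun i : Fin r => lam i - ν i = (k : ℂ)), (X - C (lam i))

open scoped Classical in
/-- The number of indices `i` with `x i = a` and `L i = k`. -/
def pairCount {ι : Type*} [Fintype ι] (x : ι → ℂ) (L : ι → ℕ) (a : ℂ) (k : ℕ) : ℕ :=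
  (Finset.univ.filter fun i => x i = a ∧ L i = k).card

open scoped Classical in
theorem count_roots_drinfeldPoly {r : ℕ} {x y : Fin r → ℂ} {L : Fin r → ℕ}
    (h : ∀ i, x i - y i = (L i : ℂ)) (a : ℂ) (k : ℕ) :
    (drinfeldPoly x y k).roots.count a = pairCount x L a k := by
  have hroots : (drinfeldPoly x y k).roots =
      (Finset.univ.filter fun i => x i - y i = (k : ℂ)).val.map x := by
    rw [← Polynomial.roots_multiset_prod_X_sub_C
      ((Finset.univ.filter fun i => x i - y i = (k : ℂ)).val.map x), Multiset.map_map]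
    rfl
  rw [hroots, Multiset.count_map, pairCount, ← Finset.filter_val, Finset.card_val,
    Finset.filter_filter]
  congr 1
  ext i
  simp [h, and_comm, eq_comm]

open scoped Classical in
theorem card_filter_eq_sum_pairCount {ι : Type*} [Fintype ι] (x : ι → ℂ) {L : ι → ℕ} {n : ℕ}
    (hL : ∀ i, L i ≤ n) (a : ℂ) :
    (Finset.univ.filter fun i => x i = a).card =
      ∑ k ∈ Finset.range (n + 1), pairCount x L a k := by
  rw [Finset.card_eq_sum_card_fiberwise (f := L) (t := Finset.range (n + 1))
    (fun i _ => by simpa [Nat.lt_succ_iff] using hL i)]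
  simp only [Finset.filter_filter, pairCount]

open scoped Classical in
theorem card_filter_sub_eq_sum_pairCount {ι : Type*} [Fintype ι] {x y : ι → ℂ} {L : ι → ℕ} {n : ℕ}
    (h : ∀ i, x i - y i = (L i : ℂ)) (hL : ∀ i, L i ≤ n) (b : ℂ) :
    (Finset.univ.filter fun i => y i = b).card =
      ∑ k ∈ Finset.range (n + 1), pairCount x L (b + k) k := by
  rw [Finset.card_eq_sum_card_fiberwise (f := L) (t := Finset.range (n + 1))
    (fun i _ => by simpa [Nat.lt_succ_iff] using hL i)]
  refine Finset.sum_congr rfl fun k _ => ?_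
  rw [Finset.filter_filter, pairCount]
  congr 1
  ext i
  simp only [Finset.mem_filter, Finset.mem_univ, true_and]
  refine and_congr_left fun hk => ?_
  rw [← hk, ← h i]
  constructor <;> intro e <;> linear_combination e

theorem pairCount_eq_zero {ι : Type*} [Fintype ι] {x : ι → ℂ} {a : ℂ} (ha : a ∉ Set.range x)
    (L : ι → ℕ) (k : ℕ) : pairCount x L a k = 0 := by
  classical
  rw [pairCount, Finset.card_eq_zero, Finset.filter_eq_empty_iff]
  exact fun i _ hi => ha ⟨i, hi.1⟩

theorem pairCount_eq_zero_of_lt {ι : Type*} [Fintype ι] (x : ι → ℂ) {L : ι → ℕ} {n k : ℕ}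
    (hL : ∀ i, L i ≤ n) (hk : n < k) (a : ℂ) : pairCount x L a k = 0 := by
  classical
  rw [pairCount, Finset.card_eq_zero, Finset.filter_eq_empty_iff]
  exact fun i _ hi => absurd (hL i) (by omega)

/-- A function on `ℂ` with a nonzero natural period and finite support vanishes. -/
theorem eq_zero_of_periodic_of_finite_support {d : ℂ → ℤ} {n : ℕ} (hn : 0 < n)
    (hd : Function.Periodic d (n : ℂ)) {s : Set ℂ} (hs : s.Finite) (hds : ∀ a ∉ s, d a = 0)
    (a : ℂ) : d a = 0 := by
  have hinj : Function.Injective fun t : ℕ => a + (t : ℂ) * n := by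
    intro t t' h
    have hn' : (n : ℂ) ≠ 0 := by exact_mod_cast hn.ne'
    exact_mod_cast mul_right_cancel₀ hn' (add_left_cancel h)
  by_contra hne
  refine Set.infinite_range_of_injective hinj (hs.subset ?_)
  rintro _ ⟨t, rfl⟩
  by_contra hmem
  have hper := hd.nat_mul t a
  exact hne (hper ▸ hds _ hmem)

/-- Two families `y, y'` with the same value multiplicities, both lying below `x` by integer steps
of size at most `n`, have the same pair counts as soon as these agree for steps strictly between
`0` and `n`. -/
theorem pairCount_eq_of_eq_of_pos_of_lt {ι : Type*} [Fintype ι] {x y y' : ι → ℂ} {L L' : ι → ℕ}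
    {n : ℕ} (hn : 0 < n) (h : ∀ i, x i - y i = (L i : ℂ)) (h' : ∀ i, x i - y' i = (L' i : ℂ))
    (hL : ∀ i, L i ≤ n) (hL' : ∀ i, L' i ≤ n) {σ : Equiv.Perm ι} (hσ : ∀ i, y' i = y (σ i))
    (hmid : ∀ a k, 1 ≤ k → k ≤ n - 1 → pairCount x L a k = pairCount x L' a k) (a : ℂ) (k : ℕ) :
    pairCount x L a k = pairCount x L' a k := by
  classical
  obtain ⟨m, rfl⟩ : ∃ m, n = m + 1 := ⟨n - 1, by omega⟩
  have hx : ∀ a, pairCount x L a 0 + pairCount x L a (m + 1) =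
      pairCount x L' a 0 + pairCount x L' a (m + 1) := by
    intro a
    have e := (card_filter_eq_sum_pairCount x hL a).symm.trans
      (card_filter_eq_sum_pairCount x hL' a)
    rw [Finset.sum_range_succ, Finset.sum_range_succ', Finset.sum_range_succ,
      Finset.sum_range_succ', Finset.sum_congr rfl fun k hk => hmid a (k + 1) (by omega)
        (by have := Finset.mem_range.1 hk; omega)] at e
    omega
  have hy : ∀ b, pairCount x L b 0 + pairCount x L (b + (m + 1 : ℕ)) (m + 1) =
      pairCount x L' b 0 + pairCount x L' (b + (m + 1 : ℕ)) (m + 1) := by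
    intro b
    have hcard : (Finset.univ.filter fun i => y' i = b).card =
        (Finset.univ.filter fun i => y i = b).card :=
      Finset.card_equiv σ fun i => by simp [hσ]
    have e := (card_filter_sub_eq_sum_pairCount h hL b).symm.trans
      (hcard.symm.trans (card_filter_sub_eq_sum_pairCount h' hL' b))
    rw [Finset.sum_range_succ, Finset.sum_range_succ', Finset.sum_range_succ,
      Finset.sum_range_succ', Finset.sum_congr rfl fun k hk => hmid _ (k + 1) (by omega)
        (by have := Finset.mem_range.1 hk; omega)] at e
    rw [Nat.cast_zero, add_zero] at e
    omega
  have hzero : ∀ a, pairCount x L a 0 = pairCount x L' a 0 := by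
    intro a
    have := eq_zero_of_periodic_of_finite_support
      (d := fun a => (pairCount x L a 0 : ℤ) - pairCount x L' a 0) hn
      (fun b => by
        have h₁ := hx (b + (m + 1 : ℕ))
        have h₂ := hy b
        beta_reduce
        omega)
      (Set.finite_range x)
      (fun a ha => by simp [pairCount_eq_zero ha]) a
    omega
  rcases Nat.eq_zero_or_pos k with rfl | hk
  · exact hzero a
  rcases Nat.lt_trichotomy k (m + 1) with hlt | rfl | hgt
  · exact hmid a k hk (by omega)
  · have := hx a
    have := hzero a
    omega
  · rw [pairCount_eq_zero_of_lt x hL hgt, pairCount_eq_zero_of_lt x hL' hgt]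

theorem exists_perm_of_pairCount_eq {ι : Type*} [Fintype ι] {x : ι → ℂ} {L L' : ι → ℕ}
    (h : ∀ a k, pairCount x L a k = pairCount x L' a k) :
    ∃ σ : Equiv.Perm ι, ∀ i, x (σ i) = x i ∧ L (σ i) = L' i := by
  classical
  have hfib : ∀ c : ℂ × ℕ, Nonempty ({i // (x i, L' i) = c} ≃ {i // (x i, L i) = c}) := by
    rintro ⟨a, k⟩
    rw [← Fintype.card_eq, Fintype.card_subtype, Fintype.card_subtype]
    simpa only [pairCount, Prod.mk.injEq] using (h a k).symm
  exact ⟨Equiv.ofFiberEquiv fun c => (hfib c).some, fun i =>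
    Prod.mk.inj (Equiv.ofFiberEquiv_map (fun c => (hfib c).some) i)⟩

open scoped Classical in
/-- Let `λ, μ ∈ ℂ^r` both be dominant and `w, w' ∈ W_r` with
`w·μ, w'·μ ∈ S^{(n)}(λ;ℓ)`. Then `Q_{λ,w·μ;k} = Q_{λ,w'·μ;k}` for all `k = 1,…,n−1`
if and only if `W_λ w W_μ = W_λ w' W_μ`. -/
theorem statement6 (n ℓ r : ℕ) (hn : 0 < n) (hℓ : 0 < ℓ) (hr : 0 < r)
    (lam μ : Fin r → ℂ)
    (hdomLam : ∀ i j : Fin r, i < j → ∀ m : ℕ, lam i - lam j ≠ -((m : ℂ) + 1))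
    (hdomMu : ∀ i j : Fin r, i < j → ∀ m : ℕ, μ i - μ j ≠ -((m : ℂ) + 1))
    (w w' : Equiv.Perm (Fin r))
    (Lw Lw' : Fin r → ℕ)
    (hw : ∀ i, lam i - μ (w⁻¹ i) = (Lw i : ℂ))
    (hw' : ∀ i, lam i - μ (w'⁻¹ i) = (Lw' i : ℂ))
    (hwsum : ∑ i, Lw i = ℓ) (hw'sum : ∑ i, Lw' i = ℓ)
    (hwn : ∀ i, Lw i ≤ n) (hw'n : ∀ i, Lw' i ≤ n) :
    (∀ k : ℕ, 1 ≤ k → k ≤ n - 1 →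
        drinfeldPoly lam (fun i => μ (w⁻¹ i)) k =
          drinfeldPoly lam (fun i => μ (w'⁻¹ i)) k) ↔
      (∃ a b : Equiv.Perm (Fin r),
        (∀ i, lam (a⁻¹ i) = lam i) ∧ (∀ i, μ (b⁻¹ i) = μ i) ∧ w' = a * w * b) := by
  constructor
  · intro hQ
    have hcount := pairCount_eq_of_eq_of_pos_of_lt (σ := w * w'⁻¹) hn
      hw hw' hwn hw'n (fun i => by simp)
      (fun a k hk hkn => by
        rw [← count_roots_drinfeldPoly hw, ← count_roots_drinfeldPoly hw', hQ k hk hkn])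
    obtain ⟨σ, hσ⟩ := exists_perm_of_pairCount_eq hcount
    have hμ : ∀ i, μ (w⁻¹ (σ i)) = μ (w'⁻¹ i) := by
      intro i
      have h₁ := hw (σ i)
      rw [(hσ i).1, (hσ i).2, ← hw' i] at h₁
      exact sub_right_injective h₁
    refine ⟨σ⁻¹, w⁻¹ * σ * w', fun i => by simpa using (hσ i).1, fun i => ?_, by group⟩
    simpa [mul_assoc] using (hμ (σ⁻¹ (w i))).symm
  · rintro ⟨a, b, ha, hb, rfl⟩ k - -
    have hlam : ∀ i, lam (a i) = lam i := fun i => by simpa using (ha (a i)).symm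
    have hμ : ∀ i, μ ((a * w * b)⁻¹ (a i)) = μ (w⁻¹ i) := fun i => by
      simpa using hb (w⁻¹ i)
    exact Finset.prod_equiv a
      (fun i => by simp only [Finset.mem_filter, Finset.mem_univ, hlam, hμ])
      (fun i _ => by rw [hlam])
end
end

section
/- Let a ∈ ℂ, b = a + ℓ − 1, and assume ℓ ≤ n. Let u_1,…,u_n be the standard basis of ℂ^n and let v ∈ D_ℓ(ℂ_{[a,b]}) be the class of 1_{[a,b]} ⊗ u_1 ⊗ u_2 ⊗ ⋯ ⊗ u_ℓ. Then v ≠ 0 and, for all d ≥ 0: t_{ij}^{(d)}·v = 0 for all 1 ≤ i < j ≤ n; t_{ii}^{(d)}·v = a^d·v for 1 ≤ i ≤ ℓ; and t_{ii}^{(d)}·v = 0 for ℓ < i ≤ n. Equivalently, v is a highest weight vector whose highest weight (ζ_1(u),…,ζ_n(u)), defined by t_{ii}(u−i)·v = ζ_i(u)·v, satisfies ζ_i(u) = 1 + 1/(u−i−a) for 1 ≤ i ≤ ℓ and ζ_i(u) = 1 for ℓ < i ≤ n. -/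
set_option synthInstance.maxHeartbeats 1000000
set_option maxHeartbeats 1000000

noncomputable section

open scoped TensorProduct

section Drinfeld

variable {ℓ n : ℕ} (ρ : Hecke ℓ →ₐ[ℂ] Module.End ℂ ℂ)

theorem rho_y_pow {a : ℂ} (hρw : ∀ w : Equiv.Perm (Fin ℓ), ρ (Hecke.sigma w) = LinearMap.id)
    (hρe : ∀ i : Fin ℓ, ρ (Hecke.eps i) = (a + (i : ℕ)) • LinearMap.id) (m : Fin ℓ) (d : ℕ) :
    ρ (Hecke.y m ^ d) = a ^ d • LinearMap.id := by
  have hy : ρ (Hecke.y m) = a • (1 : Module.End ℂ ℂ) := by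
    have hcard : (Finset.univ.filter (fun j : Fin ℓ => j < m)).card = (m : ℕ) := by
      rw [Finset.filter_gt_eq_Iio, Fin.card_Iio]
    ext
    simp [Hecke.y, hρw, hρe, hcard]
  rw [map_pow, hy, smul_pow, one_pow]
  rfl

theorem sumOp_eq_smul {a : ℂ} (hρw : ∀ w : Equiv.Perm (Fin ℓ), ρ (Hecke.sigma w) = LinearMap.id)
    (hρe : ∀ i : Fin ℓ, ρ (Hecke.eps i) = (a + (i : ℕ)) • LinearMap.id)
    (i j : Fin n) (d : ℕ) (f : MW ℓ n ℂ) :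
    sumOp n ρ i j d f = a ^ d • ∑ m : Fin ℓ, tauOp m i j f := by
  simp only [sumOp, LinearMap.sum_apply, Finset.smul_sum]
  refine Finset.sum_congr rfl fun m _ => ?_
  funext w
  simp [hOp, rho_y_pow ρ hρw hρe]

theorem permOp_swap_succ_add_mem_NSub
    (hρw : ∀ w : Equiv.Perm (Fin ℓ), ρ (Hecke.sigma w) = LinearMap.id)
    (i : Fin ℓ) (h : (i : ℕ) + 1 < ℓ) (f : MW ℓ n ℂ) :
    permOp n (Equiv.swap i ⟨(i : ℕ) + 1, h⟩) f + f ∈ NSub n ρ := by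
  refine Submodule.mem_iSup_of_mem i (Submodule.mem_iSup_of_mem h ⟨f, ?_⟩)
  funext w
  simp [sOp, hOp, hρw]

/-- Modulo `N(M)`, a permutation of the tensor factors acts by its sign. -/
theorem permOp_sub_sign_smul_mem_NSub
    (hρw : ∀ w : Equiv.Perm (Fin ℓ), ρ (Hecke.sigma w) = LinearMap.id)
    (σ : Equiv.Perm (Fin ℓ)) (f : MW ℓ n ℂ) :
    permOp n σ f - ((Equiv.Perm.sign σ : ℤ) : ℂ) • f ∈ NSub n ρ := by
  obtain _ | k := ℓ
  · have hσ : σ = 1 := Subsingleton.elim _ _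
    have : permOp n (1 : Equiv.Perm (Fin 0)) f = f := rfl
    simp [hσ, this]
  have hσ : σ ∈ Submonoid.closure
      (Set.range fun i : Fin k => Equiv.swap i.castSucc i.succ) := by
    rw [Equiv.Perm.mclosure_swap_castSucc_succ]
    trivial
  induction hσ using Submonoid.closure_induction generalizing f with
  | one =>
    have : permOp n (1 : Equiv.Perm (Fin (k + 1))) f = f := rfl
    simp [this]
  | mem τ hτ =>
    obtain ⟨i, rfl⟩ := hτ
    have : permOp n (Equiv.swap i.castSucc i.succ) f + f ∈ NSub n ρ :=
      permOp_swap_succ_add_mem_NSub ρ hρw i.castSucc (by simp) f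
    simpa [Equiv.Perm.sign_swap (Fin.castSucc_lt_succ (i := i)).ne] using this
  | mul σ τ _ _ hσ hτ =>
    have hmul : permOp n (σ * τ) f = permOp n σ (permOp n τ f) := rfl
    have := (NSub n ρ).add_mem (hσ (permOp n τ f))
      ((NSub n ρ).smul_mem ((Equiv.Perm.sign σ : ℤ) : ℂ) (hτ f))
    convert this using 1
    rw [hmul, map_mul]
    push_cast
    module

theorem mem_NSub_of_permOp_swap_eq
    (hρw : ∀ w : Equiv.Perm (Fin ℓ), ρ (Hecke.sigma w) = LinearMap.id)
    {i j : Fin ℓ} (hij : i ≠ j) {f : MW ℓ n ℂ} (hf : permOp n (Equiv.swap i j) f = f) :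
    f ∈ NSub n ρ := by
  have h := permOp_sub_sign_smul_mem_NSub ρ hρw (Equiv.swap i j) f
  rw [hf, Equiv.Perm.sign_swap hij] at h
  have h2 := (NSub n ρ).smul_mem (2⁻¹ : ℂ) h
  convert h2 using 1
  push_cast
  module

/-- The alternating sum of the coefficients at the rearrangements of the word `w₀`. -/
def altSum (w₀ : Word ℓ n) : MW ℓ n ℂ →ₗ[ℂ] ℂ :=
  ∑ σ : Equiv.Perm (Fin ℓ), ((Equiv.Perm.sign σ : ℤ) : ℂ) • LinearMap.proj (w₀ ∘ σ)

theorem altSum_apply (w₀ : Word ℓ n) (f : MW ℓ n ℂ) :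
    altSum w₀ f = ∑ σ : Equiv.Perm (Fin ℓ), ((Equiv.Perm.sign σ : ℤ) : ℂ) * f (w₀ ∘ σ) := by
  simp [altSum]

theorem altSum_permOp_swap (w₀ : Word ℓ n) {i j : Fin ℓ} (hij : i ≠ j) (f : MW ℓ n ℂ) :
    altSum w₀ (permOp n (Equiv.swap i j) f) = -altSum w₀ f := by
  rw [altSum_apply, altSum_apply, ← Finset.sum_neg_distrib]
  refine Fintype.sum_equiv (Equiv.mulRight (Equiv.swap i j)) _ _ fun σ => ?_
  simp [permOp, Equiv.Perm.sign_swap hij, Function.comp_assoc]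

theorem NSub_le_ker_altSum
    (hρw : ∀ w : Equiv.Perm (Fin ℓ), ρ (Hecke.sigma w) = LinearMap.id) (w₀ : Word ℓ n) :
    NSub n ρ ≤ LinearMap.ker (altSum w₀) := by
  refine iSup_le fun i => iSup_le fun h => ?_
  rintro _ ⟨f, rfl⟩
  have hs : sOp n ρ i ⟨(i : ℕ) + 1, h⟩ f = permOp n (Equiv.swap i ⟨(i : ℕ) + 1, h⟩) f := by
    funext w
    simp [sOp, hOp, hρw]
  have hne : i ≠ ⟨(i : ℕ) + 1, h⟩ := fun e => by simpa using congrArg Fin.val e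
  simp [hs, altSum_permOp_swap w₀ hne]

theorem altSum_single {w₀ : Word ℓ n} (hw : Function.Injective w₀) :
    altSum w₀ (fun w => if w = w₀ then 1 else 0) = 1 := by
  rw [altSum_apply, Finset.sum_eq_single 1]
  · simp
  · intro σ _ hσ
    rw [if_neg, mul_zero]
    intro h
    exact hσ (Equiv.ext fun m => hw (congrFun h m))
  · simp

/-- `τ_m(E_{ij})` applied to a basis vector. -/
theorem tauOp_single (w₀ : Word ℓ n) (m : Fin ℓ) (i j : Fin n) :
    tauOp m i j (fun w => if w = w₀ then (1 : ℂ) else 0) =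
      if w₀ m = j then fun w => if w = Function.update w₀ m i then 1 else 0 else 0 := by
  funext w
  have key : (w m = i ∧ Function.update w m j = w₀) ↔
      (w₀ m = j ∧ w = Function.update w₀ m i) := by
    constructor
    · rintro ⟨rfl, rfl⟩
      simp
    · rintro ⟨rfl, rfl⟩
      simp
  have : tauOp m i j (fun w => if w = w₀ then (1 : ℂ) else 0) w =
      if w m = i ∧ Function.update w m j = w₀ then 1 else 0 := by
    simp only [tauOp, LinearMap.coe_mk, AddHom.coe_mk, ite_and]
  rw [this, if_congr key rfl rfl, ite_and]
  split_ifs <;> simp_all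

/-- A basis vector whose word is fixed by a transposition of positions lies in `N(M)`. -/
theorem single_mem_NSub
    (hρw : ∀ w : Equiv.Perm (Fin ℓ), ρ (Hecke.sigma w) = LinearMap.id)
    {w₀ : Word ℓ n} {p q : Fin ℓ} (hpq : p ≠ q) (h : w₀ p = w₀ q) :
    (fun w => if w = w₀ then (1 : ℂ) else 0) ∈ NSub n ρ := by
  refine mem_NSub_of_permOp_swap_eq ρ hρw hpq ?_
  have hfix : w₀ ∘ Equiv.swap p q = w₀ := by
    rw [Equiv.comp_swap_eq_update, h, Function.update_eq_self, ← h, Function.update_eq_self]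
  funext w
  have : w ∘ Equiv.swap p q = w₀ ↔ w = w₀ := by
    rw [← (Equiv.swap p q).surjective.injective_comp_right.eq_iff (a := w), hfix]
  simp [permOp, this]

end Drinfeld

/-- Let `a ∈ ℂ`, `b = a + ℓ − 1`, `ℓ ≤ n`, and let `v ∈ D_ℓ(ℂ_{[a,b]})`
be the class of `1_{[a,b]} ⊗ u_1 ⊗ u_2 ⊗ ⋯ ⊗ u_ℓ`. Then `v ≠ 0` and for all `d ≥ 0`:
`t_{ij}^{(d)}·v = 0` for `i < j`; `t_{ii}^{(d)}·v = a^d·v` for `1 ≤ i ≤ ℓ`; and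
`t_{ii}^{(d)}·v = 0` for `ℓ < i ≤ n`. (Thus `v` is a highest weight vector with
highest weight `ζ_i(u) = 1 + 1/(u−i−a)` for `i ≤ ℓ` and `ζ_i(u) = 1` for `i > ℓ`.) -/
theorem statement11 (n ℓ : ℕ) (hn : 0 < n) (hℓ : 0 < ℓ) (hln : ℓ ≤ n) (a : ℂ)
    (ρ : Hecke ℓ →ₐ[ℂ] Module.End ℂ ℂ)
    (hρw : ∀ w : Equiv.Perm (Fin ℓ), ρ (Hecke.sigma w) = LinearMap.id)
    (hρe : ∀ i : Fin ℓ, ρ (Hecke.eps i) = (a + (i : ℕ)) • LinearMap.id)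
    (π : Yangian n →ₐ[ℂ] Module.End ℂ (Dmod n ρ))
    (hπ : IsDrinfeldAction n ρ π) :
    -- `v` is the class of `1 ⊗ u_1 ⊗ ⋯ ⊗ u_ℓ`:
    let f₀ : MW ℓ n ℂ := fun w => if w = (fun m : Fin ℓ => Fin.castLE hln m) then 1 else 0
    let v : Dmod n ρ := Submodule.Quotient.mk f₀
    v ≠ 0 ∧
    (∀ (i j : Fin n) (d : ℕ), i < j → π (Yangian.t i j d) v = 0) ∧
    (∀ (i : Fin n) (d : ℕ), (i : ℕ) < ℓ → π (Yangian.t i i d) v = a ^ d • v) ∧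
    (∀ (i : Fin n) (d : ℕ), ℓ ≤ (i : ℕ) → π (Yangian.t i i d) v = 0) := by
  intro f₀ v
  have hπv : ∀ (i j : Fin n) (d : ℕ), π (Yangian.t i j d) v =
      a ^ d • Submodule.Quotient.mk (∑ m : Fin ℓ, tauOp m i j f₀) := fun i j d => by
    rw [hπ, sumOp_eq_smul ρ hρw hρe, Submodule.Quotient.mk_smul]
  refine ⟨fun hv => ?_, fun i j d hij => ?_, fun i d hi => ?_, fun i d hi => ?_⟩
  · have hker := NSub_le_ker_altSum ρ hρw
      (fun m => Fin.castLE hln m) ((Submodule.Quotient.mk_eq_zero _).1 hv)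
    exact one_ne_zero ((altSum_single (Fin.castLE_injective hln)).symm.trans hker)
  · rw [hπv, (Submodule.Quotient.mk_eq_zero _).2, smul_zero]
    refine Submodule.sum_mem _ fun m _ => ?_
    rw [tauOp_single]
    split_ifs with hm
    · have him : (i : ℕ) < m := by simpa [← hm] using Fin.lt_def.1 hij
      have hne : (⟨i, him.trans m.2⟩ : Fin ℓ) ≠ m := fun e => him.ne (congrArg Fin.val e)
      refine single_mem_NSub ρ hρw hne ?_
      rw [Function.update_of_ne hne, Function.update_self]
      rfl
    · exact zero_mem _
  · rw [hπv, Finset.sum_eq_single ⟨i, hi⟩]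
    · rw [tauOp_single, if_pos (by rfl), Function.update_eq_self_iff.2 (by rfl)]
    · intro m _ hm
      rw [tauOp_single, if_neg]
      rintro rfl
      exact hm rfl
    · simp
  · rw [hπv, Finset.sum_eq_zero, Submodule.Quotient.mk_zero, smul_zero]
    intro m _
    rw [tauOp_single, if_neg]
    rintro rfl
    exact absurd m.2 (not_lt.2 hi)
end
end

section
/- The Drinfeld functor is exact: for every short exact sequence 0 → M′ → M → M″ → 0 of H_ℓ-modules, the induced sequence 0 → D_ℓ(M′) → D_ℓ(M) → D_ℓ(M″) → 0 of Y(gl_n)-modules (with maps induced by f ↦ f ⊗ id on M ⊗ (ℂ^n)^{⊗ℓ}) is exact. -/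
set_option synthInstance.maxHeartbeats 1000000
set_option maxHeartbeats 1000000

noncomputable section

open scoped TensorProduct

section Exactness

variable {n ℓ : ℕ} {M M₂ : Type} [AddCommGroup M] [Module ℂ M] [AddCommGroup M₂] [Module ℂ M₂]
  {ρ : Hecke ℓ →ₐ[ℂ] Module.End ℂ M} {ρ₂ : Hecke ℓ →ₐ[ℂ] Module.End ℂ M₂}

theorem Hecke.sigma_mul_s13 (v w : Equiv.Perm (Fin ℓ)) :
    Hecke.sigma (v * w) = Hecke.sigma v * Hecke.sigma w := by
  unfold Hecke.sigma
  rw [← map_mul]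
  exact (RingQuot.mkAlgHom_rel ℂ (HRel.permMul v w)).symm

theorem Hecke.sigma_one_s13 : Hecke.sigma (1 : Equiv.Perm (Fin ℓ)) = 1 := by
  unfold Hecke.sigma
  rw [← map_one (RingQuot.mkAlgHom ℂ (HRel ℓ))]
  exact RingQuot.mkAlgHom_rel ℂ HRel.permOne

/-- The diagonal action of a permutation on `M ⊗ (ℂ^n)^{⊗ℓ}`. -/
def wOp (n : ℕ) (ρ : Hecke ℓ →ₐ[ℂ] Module.End ℂ M) (σ : Equiv.Perm (Fin ℓ)) :
    MW ℓ n M →ₗ[ℂ] MW ℓ n M :=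
  hOp n ρ (Hecke.sigma σ) ∘ₗ permOp n σ

theorem wOp_apply (σ : Equiv.Perm (Fin ℓ)) (u : MW ℓ n M) (w : Word ℓ n) :
    wOp n ρ σ u w = ρ (Hecke.sigma σ) (u (w ∘ σ)) := rfl

theorem wOp_mul (σ τ : Equiv.Perm (Fin ℓ)) (u : MW ℓ n M) :
    wOp n ρ (σ * τ) u = wOp n ρ σ (wOp n ρ τ u) := by
  funext w
  simp only [wOp_apply, Hecke.sigma_mul_s13, map_mul, Module.End.mul_apply]
  rfl

theorem wOp_one (u : MW ℓ n M) : wOp n ρ 1 u = u := by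
  funext w
  simp only [wOp_apply, Hecke.sigma_one_s13, map_one, Module.End.one_apply]
  rfl

theorem compLeft_wOp {f : M →ₗ[ℂ] M₂} (hf : ∀ h x, f (ρ h x) = ρ₂ h (f x))
    (σ : Equiv.Perm (Fin ℓ)) (u : MW ℓ n M) :
    f.compLeft (Word ℓ n) (wOp n ρ σ u) = wOp n ρ₂ σ (f.compLeft (Word ℓ n) u) := by
  funext w
  exact hf _ _

theorem compLeft_sumOp {f : M →ₗ[ℂ] M₂} (hf : ∀ h x, f (ρ h x) = ρ₂ h (f x))
    (a b : Fin n) (d : ℕ) (u : MW ℓ n M) :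
    f.compLeft (Word ℓ n) (sumOp n ρ a b d u) = sumOp n ρ₂ a b d (f.compLeft (Word ℓ n) u) := by
  simp only [sumOp, LinearMap.sum_apply, map_sum]
  refine Finset.sum_congr rfl fun m _ => ?_
  funext w
  refine (hf _ _).trans (congrArg _ ?_)
  change f (if w m = a then _ else 0) = if w m = a then _ else 0
  split_ifs
  · rfl
  · exact map_zero f

theorem wOp_swap_add_mem_NSub (i : Fin ℓ) (h : (i : ℕ) + 1 < ℓ) (u : MW ℓ n M) :
    wOp n ρ (Equiv.swap i ⟨(i : ℕ) + 1, h⟩) u + u ∈ NSub n ρ :=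
  (le_iSup₂_of_le (f := fun (i : Fin ℓ) (h : (i : ℕ) + 1 < ℓ) =>
    LinearMap.range (sOp n ρ i ⟨(i : ℕ) + 1, h⟩ + LinearMap.id)) i h le_rfl) ⟨u, rfl⟩

theorem NSub_le {p : Submodule ℂ (MW ℓ n M)}
    (hp : ∀ (i : Fin ℓ) (h : (i : ℕ) + 1 < ℓ) (u : MW ℓ n M),
      wOp n ρ (Equiv.swap i ⟨(i : ℕ) + 1, h⟩) u + u ∈ p) : NSub n ρ ≤ p := by
  refine iSup₂_le fun i h => ?_
  rintro _ ⟨u, rfl⟩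
  exact hp i h u

theorem NSub_le_comap {f : M →ₗ[ℂ] M₂} (hf : ∀ h x, f (ρ h x) = ρ₂ h (f x)) :
    NSub n ρ ≤ (NSub n ρ₂).comap (f.compLeft (Word ℓ n)) := by
  refine NSub_le fun i h u => ?_
  rw [Submodule.mem_comap, map_add, compLeft_wOp hf]
  exact wOp_swap_add_mem_NSub i h _

theorem sign_cast_mul_self (σ : Equiv.Perm (Fin ℓ)) :
    ((Equiv.Perm.sign σ : ℤ) : ℂ) * ((Equiv.Perm.sign σ : ℤ) : ℂ) = 1 := by
  rw [← Int.cast_mul, ← Units.val_mul, Int.units_mul_self, Units.val_one, Int.cast_one]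

/-- Antisymmetrisation `Σ_σ sgn(σ) σ` on `M ⊗ (ℂ^n)^{⊗ℓ}`. -/
def antisymmOp (n : ℕ) (ρ : Hecke ℓ →ₐ[ℂ] Module.End ℂ M) : MW ℓ n M →ₗ[ℂ] MW ℓ n M :=
  ∑ σ : Equiv.Perm (Fin ℓ), ((Equiv.Perm.sign σ : ℤ) : ℂ) • wOp n ρ σ

theorem antisymmOp_apply (u : MW ℓ n M) :
    antisymmOp n ρ u = ∑ σ : Equiv.Perm (Fin ℓ), ((Equiv.Perm.sign σ : ℤ) : ℂ) • wOp n ρ σ u := by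
  simp [antisymmOp, LinearMap.sum_apply]

theorem compLeft_antisymmOp {f : M →ₗ[ℂ] M₂} (hf : ∀ h x, f (ρ h x) = ρ₂ h (f x))
    (u : MW ℓ n M) :
    f.compLeft (Word ℓ n) (antisymmOp n ρ u) = antisymmOp n ρ₂ (f.compLeft (Word ℓ n) u) := by
  simp only [antisymmOp_apply, map_sum, map_smul, compLeft_wOp hf]

theorem antisymmOp_wOp (τ : Equiv.Perm (Fin ℓ)) (u : MW ℓ n M) :
    antisymmOp n ρ (wOp n ρ τ u) = ((Equiv.Perm.sign τ : ℤ) : ℂ) • antisymmOp n ρ u := by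
  rw [antisymmOp_apply, antisymmOp_apply, Finset.smul_sum]
  refine Fintype.sum_equiv (Equiv.mulRight τ) _ _ fun σ => ?_
  rw [Equiv.coe_mulRight, wOp_mul, smul_smul, map_mul, Units.val_mul, Int.cast_mul, mul_comm,
    mul_assoc, sign_cast_mul_self, mul_one]

theorem wOp_sub_sign_smul_mem_NSub (σ : Equiv.Perm (Fin ℓ)) (u : MW ℓ n M) :
    wOp n ρ σ u - ((Equiv.Perm.sign σ : ℤ) : ℂ) • u ∈ NSub n ρ := by
  cases ℓ with
  | zero =>
    rw [Subsingleton.elim σ 1, wOp_one]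
    simp
  | succ k =>
    have hσ : σ ∈ Submonoid.closure
        (Set.range fun i : Fin k => Equiv.swap i.castSucc i.succ) := by
      rw [Equiv.Perm.mclosure_swap_castSucc_succ]
      trivial
    induction hσ using Submonoid.closure_induction_left with
    | one => simp [wOp_one]
    | mul_left s hs τ _ ih =>
      obtain ⟨i, rfl⟩ := hs
      have hi := wOp_swap_add_mem_NSub (ρ := ρ) i.castSucc (by simp) (wOp n ρ τ u)
      have hsign : Equiv.Perm.sign (Equiv.swap i.castSucc i.succ) = -1 :=
        Equiv.Perm.sign_swap i.castSucc_lt_succ.ne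
      convert sub_mem hi ih using 1
      rw [wOp_mul, map_mul, hsign]
      simp only [neg_mul, one_mul, Units.val_neg, Int.cast_neg, neg_smul]
      change wOp n ρ (Equiv.swap i.castSucc i.succ) _ - _
        = wOp n ρ (Equiv.swap i.castSucc i.succ) _ + _ - _
      abel

theorem antisymmOp_sub_factorial_smul_mem_NSub (u : MW ℓ n M) :
    antisymmOp n ρ u - (ℓ.factorial : ℂ) • u ∈ NSub n ρ := by
  have h : (ℓ.factorial : ℂ) • u = ∑ _σ : Equiv.Perm (Fin ℓ), u := by
    rw [Finset.sum_const, Finset.card_univ, Fintype.card_perm, Fintype.card_fin,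
      Nat.cast_smul_eq_nsmul]
  rw [antisymmOp_apply, h, ← Finset.sum_sub_distrib]
  refine sum_mem fun σ _ => ?_
  have := (NSub n ρ).smul_mem ((Equiv.Perm.sign σ : ℤ) : ℂ) (wOp_sub_sign_smul_mem_NSub σ u)
  rwa [smul_sub, smul_smul, sign_cast_mul_self, one_smul] at this

theorem NSub_eq_ker_antisymmOp : NSub n ρ = LinearMap.ker (antisymmOp n ρ) := by
  refine le_antisymm (NSub_le fun i h u => ?_) fun u hu => ?_
  · have hne : i ≠ ⟨(i : ℕ) + 1, h⟩ := fun e => by simpa using congrArg Fin.val e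
    rw [LinearMap.mem_ker, map_add, antisymmOp_wOp, Equiv.Perm.sign_swap hne]
    simp
  · have h := antisymmOp_sub_factorial_smul_mem_NSub (ρ := ρ) u
    rw [LinearMap.mem_ker.1 hu, zero_sub, neg_mem_iff] at h
    exact ((NSub n ρ).smul_mem_iff (Nat.cast_ne_zero.2 ℓ.factorial_ne_zero)).1 h

/-- The map `D_ℓ(f)` induced by a homomorphism `f` of `H_ℓ`-modules. -/
def Dmap (n : ℕ) {f : M →ₗ[ℂ] M₂} (hf : ∀ h x, f (ρ h x) = ρ₂ h (f x)) :
    Dmod n ρ →ₗ[ℂ] Dmod n ρ₂ :=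
  (NSub n ρ).mapQ (NSub n ρ₂) (f.compLeft (Word ℓ n)) (NSub_le_comap hf)

theorem Dmap_mk {f : M →ₗ[ℂ] M₂} (hf : ∀ h x, f (ρ h x) = ρ₂ h (f x)) (u : MW ℓ n M) :
    Dmap n hf (Submodule.Quotient.mk u) = Submodule.Quotient.mk (f.compLeft (Word ℓ n) u) :=
  rfl

/-- Linear maps commuting with the generators `t_{ij}^{(d)}` are `Y(gl_n)`-linear. -/
theorem Yangian.map_apply_of_map_t {V V₂ : Type} [AddCommGroup V] [Module ℂ V]
    [AddCommGroup V₂] [Module ℂ V₂] {π : Yangian n →ₐ[ℂ] Module.End ℂ V}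
    {π₂ : Yangian n →ₐ[ℂ] Module.End ℂ V₂} {F : V →ₗ[ℂ] V₂}
    (hF : ∀ a b d x, F (π (Yangian.t a b d) x) = π₂ (Yangian.t a b d) (F x))
    (y : Yangian n) (x : V) : F (π y x) = π₂ y (F x) := by
  obtain ⟨y, rfl⟩ := RingQuot.mkAlgHom_surjective ℂ (YRel n) y
  induction y using FreeAlgebra.induction generalizing x with
  | grade0 r => simp only [AlgHom.commutes, Module.algebraMap_end_apply, map_smul]
  | grade1 t => exact hF t.1 t.2.1 t.2.2 x
  | mul a b ha hb => simp only [map_mul, Module.End.mul_apply, ha, hb]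
  | add a b ha hb => simp only [map_add, LinearMap.add_apply, ha, hb]

theorem Dmap_yangian {f : M →ₗ[ℂ] M₂} (hf : ∀ h x, f (ρ h x) = ρ₂ h (f x))
    {π : Yangian n →ₐ[ℂ] Module.End ℂ (Dmod n ρ)} (hπ : IsDrinfeldAction n ρ π)
    {π₂ : Yangian n →ₐ[ℂ] Module.End ℂ (Dmod n ρ₂)} (hπ₂ : IsDrinfeldAction n ρ₂ π₂)
    (y : Yangian n) (x : Dmod n ρ) : Dmap n hf (π y x) = π₂ y (Dmap n hf x) := by
  refine Yangian.map_apply_of_map_t (fun a b d x => ?_) y x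
  obtain ⟨u, rfl⟩ := Submodule.Quotient.mk_surjective _ x
  rw [hπ, Dmap_mk, Dmap_mk, hπ₂, compLeft_sumOp hf]

theorem Dmap_injective {f : M →ₗ[ℂ] M₂} (hf : ∀ h x, f (ρ h x) = ρ₂ h (f x))
    (hinj : Function.Injective f) : Function.Injective (Dmap n hf) := by
  rw [injective_iff_map_eq_zero]
  intro x hx
  obtain ⟨u, rfl⟩ := Submodule.Quotient.mk_surjective _ x
  rw [Dmap_mk, Submodule.Quotient.mk_eq_zero, NSub_eq_ker_antisymmOp, LinearMap.mem_ker,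
    ← compLeft_antisymmOp hf] at hx
  rw [Submodule.Quotient.mk_eq_zero, NSub_eq_ker_antisymmOp, LinearMap.mem_ker]
  funext w
  exact hinj ((congrFun hx w).trans (map_zero f).symm)

theorem Dmap_surjective {f : M →ₗ[ℂ] M₂} (hf : ∀ h x, f (ρ h x) = ρ₂ h (f x))
    (hsurj : Function.Surjective f) : Function.Surjective (Dmap n hf) := by
  intro x
  obtain ⟨u, rfl⟩ := Submodule.Quotient.mk_surjective _ x
  choose v hv using fun w => hsurj (u w)
  exact ⟨Submodule.Quotient.mk v, congrArg _ (funext hv)⟩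

theorem range_Dmap_eq_ker_Dmap {M₃ : Type} [AddCommGroup M₃] [Module ℂ M₃]
    {ρ₃ : Hecke ℓ →ₐ[ℂ] Module.End ℂ M₃} {f : M →ₗ[ℂ] M₂} {g : M₂ →ₗ[ℂ] M₃}
    (hf : ∀ h x, f (ρ h x) = ρ₂ h (f x)) (hg : ∀ h x, g (ρ₂ h x) = ρ₃ h (g x))
    (hexact : LinearMap.range f = LinearMap.ker g) :
    LinearMap.range (Dmap n hf) = LinearMap.ker (Dmap n hg) := by
  refine le_antisymm ?_ fun x hx => ?_
  · rintro _ ⟨x, rfl⟩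
    obtain ⟨u, rfl⟩ := Submodule.Quotient.mk_surjective _ x
    rw [LinearMap.mem_ker, Dmap_mk, Dmap_mk]
    refine congrArg _ (funext fun w => ?_ : _ = (0 : MW ℓ n M₃))
    exact LinearMap.mem_ker.1 (hexact ▸ LinearMap.mem_range_self f (u w))
  · obtain ⟨u, rfl⟩ := Submodule.Quotient.mk_surjective _ x
    rw [LinearMap.mem_ker, Dmap_mk, Submodule.Quotient.mk_eq_zero, NSub_eq_ker_antisymmOp,
      LinearMap.mem_ker, ← compLeft_antisymmOp hg] at hx
    have hr : ∀ w, ∃ v, f v = antisymmOp n ρ₂ u w := fun w => by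
      rw [← LinearMap.mem_range, hexact]
      exact congrFun hx w
    choose v hv using hr
    rw [← Submodule.smul_mem_iff _ (Nat.cast_ne_zero.2 ℓ.factorial_ne_zero : (ℓ.factorial : ℂ) ≠ 0)]
    refine ⟨Submodule.Quotient.mk v, ?_⟩
    rw [Dmap_mk, ← Submodule.Quotient.mk_smul, Submodule.Quotient.eq,
      show f.compLeft (Word ℓ n) v = antisymmOp n ρ₂ u from funext hv]
    exact antisymmOp_sub_factorial_smul_mem_NSub u

end Exactness

/-- The Drinfeld functor is exact: for every short exact sequence
`0 → M′ → M → M″ → 0` of `H_ℓ`-modules, the induced sequence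
`0 → D_ℓ(M′) → D_ℓ(M) → D_ℓ(M″) → 0` of `Y(gl_n)`-modules is exact. -/
theorem statement13 (n ℓ : ℕ) (hn : 0 < n) (hℓ : 0 < ℓ)
    (M' M M'' : Type)
    [AddCommGroup M'] [Module ℂ M'] [AddCommGroup M] [Module ℂ M]
    [AddCommGroup M''] [Module ℂ M'']
    (ρ' : Hecke ℓ →ₐ[ℂ] Module.End ℂ M') (ρ : Hecke ℓ →ₐ[ℂ] Module.End ℂ M)
    (ρ'' : Hecke ℓ →ₐ[ℂ] Module.End ℂ M'')
    (f : M' →ₗ[ℂ] M) (g : M →ₗ[ℂ] M'')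
    (hf : ∀ (h : Hecke ℓ) (x : M'), f (ρ' h x) = ρ h (f x))
    (hg : ∀ (h : Hecke ℓ) (x : M), g (ρ h x) = ρ'' h (g x))
    (hfinj : Function.Injective f) (hgsurj : Function.Surjective g)
    (hexact : LinearMap.range f = LinearMap.ker g)
    (π' : Yangian n →ₐ[ℂ] Module.End ℂ (Dmod n ρ')) (hπ' : IsDrinfeldAction n ρ' π')
    (π : Yangian n →ₐ[ℂ] Module.End ℂ (Dmod n ρ)) (hπ : IsDrinfeldAction n ρ π)
    (π'' : Yangian n →ₐ[ℂ] Module.End ℂ (Dmod n ρ'')) (hπ'' : IsDrinfeldAction n ρ'' π'') :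
    ∃ (F : Dmod n ρ' →ₗ[ℂ] Dmod n ρ) (G : Dmod n ρ →ₗ[ℂ] Dmod n ρ''),
      -- the maps are the ones induced by `f ⊗ id` and `g ⊗ id`:
      (∀ u : MW ℓ n M',
        F (Submodule.Quotient.mk u) = Submodule.Quotient.mk (f.compLeft (Word ℓ n) u)) ∧
      (∀ u : MW ℓ n M,
        G (Submodule.Quotient.mk u) = Submodule.Quotient.mk (g.compLeft (Word ℓ n) u)) ∧
      -- they are `Y(gl_n)`-module maps:
      (∀ y x, F (π' y x) = π y (F x)) ∧
      (∀ y x, G (π y x) = π'' y (G x)) ∧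
      -- and the induced sequence is short exact:
      Function.Injective F ∧ Function.Surjective G ∧ LinearMap.range F = LinearMap.ker G := by
  exact ⟨Dmap n hf, Dmap n hg, Dmap_mk hf, Dmap_mk hg, Dmap_yangian hf hπ' hπ,
    Dmap_yangian hg hπ hπ'', Dmap_injective hf hfinj, Dmap_surjective hg hgsurj,
    range_Dmap_eq_ker_Dmap hf hg hexact⟩
end
end

section
/- Fix a permutation (i_1,…,i_n) of (1,…,n). For γ ∈ ℤ_{≥0}^n with Σ_a γ_a = ℓ, set u_𝐢(γ) := u_{i_1}^{⊗γ_{i_1}} ⊗ u_{i_2}^{⊗γ_{i_2}} ⊗ ⋯ ⊗ u_{i_n}^{⊗γ_{i_n}} ∈ (ℂ^n)^{⊗ℓ}, and partition {1,…,ℓ} into consecutive blocks of sizes γ_{i_1}, γ_{i_2}, …, γ_{i_n}. Then the classes [y_1^{d_1} y_2^{d_2} ⋯ y_ℓ^{d_ℓ} ⊗ u_𝐢(γ)] ∈ D̄_ℓ, as γ ranges over all tuples in ℤ_{≥0}^n with Σ_a γ_a = ℓ and (d_1,…,d_ℓ) ranges over all tuples in ℤ_{≥0}^ℓ satisfying d_m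 ≥ d_{m+1} whenever m and m+1 lie in the same block, form a ℂ-basis of D̄_ℓ. -/
set_option synthInstance.maxHeartbeats 1000000
set_option maxHeartbeats 1000000

noncomputable section

open scoped TensorProduct

/-! ## The associated graded model: `ℂ[y_1,…,y_ℓ] ⊗ (ℂ^n)^{⊗ℓ}` with the
sign-twisted `W_ℓ`-action -/

/-- The polynomial ring `P = ℂ[y_1,…,y_ℓ]`. -/
abbrev PolyL (ℓ : ℕ) : Type := MvPolynomial (Fin ℓ) ℂ

/-- Concrete model for `P ⊗ (ℂ^n)^{⊗ℓ}`. -/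
abbrev PW (ℓ n : ℕ) : Type := MW ℓ n (PolyL ℓ)

/-- The sign-twisted action of `w ∈ W_ℓ` on `P ⊗ (ℂ^n)^{⊗ℓ}`:
`w·(f ⊗ v) = sgn(w)·(wf) ⊗ (wv)`. -/
def sgnOp (n : ℕ) {ℓ : ℕ} (σ : Equiv.Perm (Fin ℓ)) : PW ℓ n →ₗ[ℂ] PW ℓ n :=
  ((Equiv.Perm.sign σ : ℤ) : ℂ) •
    ((MvPolynomial.rename (σ : Fin ℓ → Fin ℓ)).toLinearMap.compLeft (Word ℓ n) ∘ₗ permOp n σ)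

/-- The subspace `Σ_{i=1}^{ℓ−1} Im(s_i + 1)` for the sign-twisted action. -/
def NPsub (n ℓ : ℕ) : Submodule ℂ (PW ℓ n) :=
  ⨆ (i : Fin ℓ) (h : (i : ℕ) + 1 < ℓ),
    LinearMap.range (sgnOp n (Equiv.swap i ⟨(i : ℕ) + 1, h⟩) + LinearMap.id)

/-- `D̄_ℓ := (P ⊗ (ℂ^n)^{⊗ℓ}) / Σ_i Im(s_i + 1)`. -/
abbrev DBar (ℓ n : ℕ) : Type := PW ℓ n ⧸ NPsub n ℓ

/-- The operator `Θ_{ab}^{(r)} = Σ_{m=1}^ℓ (y_m^r·) ⊗ τ_m(E_{ab})`, giving the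
`gl_n[t]`-module structure (`E_{ab} ⊗ t^r ↦ Θ_{ab}^{(r)}`). -/
def thetaOp (n : ℕ) {ℓ : ℕ} (a b : Fin n) (r : ℕ) : PW ℓ n →ₗ[ℂ] PW ℓ n :=
  ∑ m : Fin ℓ,
    (LinearMap.mulLeft ℂ ((MvPolynomial.X m : PolyL ℓ) ^ r)).compLeft (Word ℓ n) ∘ₗ
      tauOp m a b

/-- The offset `Σ_{b<a} γ_{i_b}` of the `a`-th block of the composition
`(γ_{i_1}, …, γ_{i_n})`. -/
def offSeq {n : ℕ} (ii : Equiv.Perm (Fin n)) (γ : Fin n → ℕ) (a : Fin n) : ℕ :=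
  ∑ b ∈ Finset.univ.filter (fun b : Fin n => b < a), γ (ii b)

/-- The index of the block (of sizes `γ_{i_1}, …, γ_{i_n}`) containing position `m`. -/
def blockOf {n : ℕ} (hn : 0 < n) (ii : Equiv.Perm (Fin n)) (γ : Fin n → ℕ) (m : ℕ) :
    Fin n :=
  (Finset.univ.filter fun a : Fin n => offSeq ii γ a ≤ m).max' (by
    refine ⟨⟨0, hn⟩, Finset.mem_filter.mpr ⟨Finset.mem_univ _, ?_⟩⟩
    have h0 : Finset.univ.filter (fun b : Fin n => b < (⟨0, hn⟩ : Fin n)) = ∅ := by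
      apply Finset.filter_eq_empty_iff.mpr
      intro b _
      simp [Fin.lt_def]
    have h1 : offSeq ii γ (⟨0, hn⟩ : Fin n) = 0 := by
      unfold offSeq
      rw [h0, Finset.sum_empty]
    rw [h1]
    exact Nat.zero_le m)

/-- The word `u_𝐢(γ) = u_{i_1}^{⊗γ_{i_1}} ⊗ ⋯ ⊗ u_{i_n}^{⊗γ_{i_n}}`. -/
def wordOf {ℓ n : ℕ} (hn : 0 < n) (ii : Equiv.Perm (Fin n)) (γ : Fin n → ℕ) :
    Word ℓ n :=
  fun m => ii (blockOf hn ii γ (m : ℕ))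

/-- The element `y_1^{d_1} ⋯ y_ℓ^{d_ℓ} ⊗ u_𝐢(γ)` of `P ⊗ (ℂ^n)^{⊗ℓ}`. -/
def belt {ℓ n : ℕ} (hn : 0 < n) (ii : Equiv.Perm (Fin n)) (γ : Fin n → ℕ)
    (d : Fin ℓ → ℕ) : PW ℓ n :=
  fun w => if w = wordOf hn ii γ then ∏ m : Fin ℓ, (MvPolynomial.X m : PolyL ℓ) ^ d m else 0

/-! ## Sorting -/

/-- Two monotone tuples with the same multiset of values are equal. -/
theorem Monotone.eq_of_map_univ_eq {ℓ : ℕ} {α : Type*} [PartialOrder α] {f g : Fin ℓ → α}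
    (hf : Monotone f) (hg : Monotone g)
    (h : (Finset.univ : Finset (Fin ℓ)).val.map f = (Finset.univ : Finset (Fin ℓ)).val.map g) :
    f = g := by
  rw [Fin.univ_val_map, Fin.univ_val_map, Multiset.coe_eq_coe] at h
  exact List.ofFn_injective (h.eq_of_sortedLE hf.sortedLE_ofFn hg.sortedLE_ofFn)

/-- Precomposition with a permutation does not change the multiset of values. -/
theorem map_univ_comp_perm {ι α : Type*} [Fintype ι] (σ : Equiv.Perm ι) (f : ι → α) :
    (Finset.univ : Finset ι).val.map (f ∘ σ) = (Finset.univ : Finset ι).val.map f := by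
  classical
  rw [← Multiset.map_map]
  congr 1
  have h := congrArg Finset.val (Finset.map_univ_equiv σ)
  rwa [Finset.map_val] at h

/-- The multiset of letters of a word is determined by the letter counts. -/
theorem map_univ_eq_iff_card {ι α : Type*} [Fintype ι] [DecidableEq α] (f g : ι → α) :
    (Finset.univ : Finset ι).val.map f = (Finset.univ : Finset ι).val.map g ↔
      ∀ a, (Finset.univ.filter fun i => f i = a).card =
        (Finset.univ.filter fun i => g i = a).card := by
  rw [Multiset.ext]
  refine forall_congr' fun a => ?_
  simp only [Multiset.count_map, Finset.card_def, Finset.filter_val, eq_comm]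

/-- The multiset of pairs (letter, exponent), a complete invariant of the `W_ℓ`-orbit of
`y^d ⊗ u_w`. -/
def content {ℓ n : ℕ} (w : Word ℓ n) (d : Fin ℓ → ℕ) : Multiset (Fin n × ℕ) :=
  (Finset.univ : Finset (Fin ℓ)).val.map fun m => (w m, d m)

theorem content_comp_perm {ℓ n : ℕ} (w : Word ℓ n) (d : Fin ℓ → ℕ) (σ : Equiv.Perm (Fin ℓ)) :
    content (w ∘ σ) (d ∘ σ) = content w d :=
  map_univ_comp_perm σ fun m => (w m, d m)

/-- The key by which positions get sorted: first by the letter, in the order `i_1, …, i_n`,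
then by decreasing exponent. -/
def sortKey {ℓ n : ℕ} (ii : Equiv.Perm (Fin n)) (w : Word ℓ n) (d : Fin ℓ → ℕ) (m : Fin ℓ) :
    Fin n ×ₗ ℕᵒᵈ :=
  toLex (ii.symm (w m), OrderDual.toDual (d m))

theorem sortKey_comp {ℓ n : ℕ} (ii : Equiv.Perm (Fin n)) (w : Word ℓ n) (d : Fin ℓ → ℕ)
    (σ : Equiv.Perm (Fin ℓ)) : sortKey ii (w ∘ σ) (d ∘ σ) = sortKey ii w d ∘ σ :=
  rfl

theorem eq_of_sortKey_eq {ℓ n : ℕ} {ii : Equiv.Perm (Fin n)} {w w' : Word ℓ n}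
    {d d' : Fin ℓ → ℕ} (h : sortKey ii w d = sortKey ii w' d') : w = w' ∧ d = d' := by
  constructor <;> funext m
  · exact ii.symm.injective (congrArg (fun x => (ofLex x).1) (congrFun h m))
  · exact congrArg (fun x => OrderDual.ofDual (ofLex x).2) (congrFun h m)

theorem map_sortKey {ℓ n : ℕ} (ii : Equiv.Perm (Fin n)) (w : Word ℓ n) (d : Fin ℓ → ℕ) :
    (Finset.univ : Finset (Fin ℓ)).val.map (sortKey ii w d) =
      (content w d).map fun x => (toLex (ii.symm x.1, OrderDual.toDual x.2) : Fin n ×ₗ ℕᵒᵈ) := by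
  rw [content, Multiset.map_map]
  rfl

/-! ## Blocks -/

theorem offSeq_add_le {n : ℕ} (ii : Equiv.Perm (Fin n)) (γ : Fin n → ℕ) {b c : Fin n}
    (h : b < c) : offSeq ii γ b + γ (ii b) ≤ offSeq ii γ c := by
  unfold offSeq
  rw [add_comm, ← Finset.sum_insert (f := fun b => γ (ii b)) (by simp)]
  refine Finset.sum_le_sum_of_subset fun x hx => ?_
  simp only [Finset.mem_insert, Finset.mem_filter, Finset.mem_univ, true_and] at hx ⊢
  rcases hx with rfl | hx
  exacts [h, hx.trans h]

theorem offSeq_succ {n : ℕ} (ii : Equiv.Perm (Fin n)) (γ : Fin n → ℕ) (b : Fin n)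
    (h : (b : ℕ) + 1 < n) : offSeq ii γ ⟨b + 1, h⟩ = offSeq ii γ b + γ (ii b) := by
  unfold offSeq
  rw [add_comm (∑ _ ∈ _, _), ← Finset.sum_insert (f := fun b => γ (ii b)) (by simp)]
  congr 1
  ext x
  simp only [Finset.mem_insert, Finset.mem_filter, Finset.mem_univ, true_and, Fin.lt_def,
    Fin.ext_iff]
  omega

theorem offSeq_add_le_sum {n : ℕ} (ii : Equiv.Perm (Fin n)) (γ : Fin n → ℕ) (b : Fin n) :
    offSeq ii γ b + γ (ii b) ≤ ∑ a, γ a := by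
  unfold offSeq
  rw [add_comm, ← Finset.sum_insert (f := fun b => γ (ii b)) (by simp), ← Equiv.sum_comp ii]
  exact Finset.sum_le_sum_of_subset (Finset.subset_univ _)

theorem offSeq_last {n : ℕ} (ii : Equiv.Perm (Fin n)) (γ : Fin n → ℕ) (b : Fin n)
    (h : ¬ (b : ℕ) + 1 < n) : offSeq ii γ b + γ (ii b) = ∑ a, γ a := by
  unfold offSeq
  rw [add_comm, ← Finset.sum_insert (f := fun b => γ (ii b)) (by simp), ← Equiv.sum_comp ii]
  congr 1
  ext x
  simp only [Finset.mem_insert, Finset.mem_filter, Finset.mem_univ, true_and, Fin.lt_def,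
    Fin.ext_iff, iff_true]
  omega

theorem offSeq_blockOf_le {n : ℕ} (hn : 0 < n) (ii : Equiv.Perm (Fin n)) (γ : Fin n → ℕ)
    (m : ℕ) : offSeq ii γ (blockOf hn ii γ m) ≤ m :=
  (Finset.mem_filter.mp (Finset.max'_mem (Finset.univ.filter fun a => offSeq ii γ a ≤ m) _)).2

theorem le_blockOf {n : ℕ} (hn : 0 < n) (ii : Equiv.Perm (Fin n)) (γ : Fin n → ℕ) {m : ℕ}
    {b : Fin n} (h : offSeq ii γ b ≤ m) : b ≤ blockOf hn ii γ m :=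
  Finset.le_max' (Finset.univ.filter fun a => offSeq ii γ a ≤ m) b
    (Finset.mem_filter.mpr ⟨Finset.mem_univ _, h⟩)

theorem blockOf_mono {n : ℕ} (hn : 0 < n) (ii : Equiv.Perm (Fin n)) (γ : Fin n → ℕ) :
    Monotone (blockOf hn ii γ) := fun _ _ h =>
  le_blockOf hn ii γ ((offSeq_blockOf_le hn ii γ _).trans h)

theorem blockOf_eq_iff {n : ℕ} (hn : 0 < n) (ii : Equiv.Perm (Fin n)) (γ : Fin n → ℕ) {m : ℕ}
    (hm : m < ∑ a, γ a) (b : Fin n) :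
    blockOf hn ii γ m = b ↔ offSeq ii γ b ≤ m ∧ m < offSeq ii γ b + γ (ii b) := by
  constructor
  · rintro rfl
    refine ⟨offSeq_blockOf_le hn ii γ m, ?_⟩
    by_contra! hlt
    by_cases hb : ((blockOf hn ii γ m : Fin n) : ℕ) + 1 < n
    · rw [← offSeq_succ ii γ _ hb] at hlt
      have := le_blockOf hn ii γ hlt
      rw [Fin.le_def] at this
      simp at this
    · rw [offSeq_last ii γ _ hb] at hlt
      omega
  · rintro ⟨h₁, h₂⟩
    refine ((le_blockOf hn ii γ h₁).eq_or_lt.resolve_right fun hlt => ?_).symm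
    have := offSeq_add_le ii γ hlt
    have := offSeq_blockOf_le hn ii γ m
    omega

/-- The letter `a` occurs `γ_a` times in `u_𝐢(γ)`. -/
theorem card_wordOf_eq {ℓ n : ℕ} (hn : 0 < n) (ii : Equiv.Perm (Fin n)) (γ : Fin n → ℕ)
    (hγ : ∑ a, γ a = ℓ) (a : Fin n) :
    (Finset.univ.filter fun m : Fin ℓ => (wordOf hn ii γ : Word ℓ n) m = a).card = γ a := by
  obtain ⟨b, rfl⟩ := ii.surjective a
  have hle := offSeq_add_le_sum ii γ b
  rw [← Finset.card_map Fin.valEmbedding]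
  trans (Finset.Ico (offSeq ii γ b) (offSeq ii γ b + γ (ii b))).card
  · congr 1
    ext m
    simp only [Finset.mem_map, Finset.mem_filter, Finset.mem_univ, true_and,
      Fin.valEmbedding_apply, Finset.mem_Ico, wordOf, ii.injective.eq_iff]
    constructor
    · rintro ⟨m, h, rfl⟩
      exact (blockOf_eq_iff hn ii γ (hγ ▸ m.2) b).mp h
    · intro h
      have hm : m < ∑ a, γ a := by omega
      exact ⟨⟨m, hγ ▸ hm⟩, (blockOf_eq_iff hn ii γ hm b).mpr h, rfl⟩
  · simp

theorem symm_wordOf_mono {ℓ n : ℕ} (hn : 0 < n) (ii : Equiv.Perm (Fin n)) (γ : Fin n → ℕ) :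
    Monotone fun m => ii.symm ((wordOf hn ii γ : Word ℓ n) m) := fun _ _ h => by
  simpa [wordOf] using blockOf_mono hn ii γ h

theorem sum_card_letter {ℓ n : ℕ} (w : Word ℓ n) :
    ∑ a, (Finset.univ.filter fun m => w m = a).card = ℓ := by
  rw [← Finset.card_eq_sum_card_fiberwise (fun _ _ => Finset.mem_univ _)]
  simp

/-- A word whose letters occur in the order `i_1, …, i_n` is `u_𝐢(γ)` for its letter
counts `γ`. -/
theorem wordOf_card_eq {ℓ n : ℕ} (hn : 0 < n) (ii : Equiv.Perm (Fin n)) (w : Word ℓ n)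
    (hw : Monotone fun m => ii.symm (w m)) :
    wordOf hn ii (fun a => (Finset.univ.filter fun m => w m = a).card) = w := by
  have h := (map_univ_eq_iff_card _ w).mpr (card_wordOf_eq hn ii _ (sum_card_letter w))
  have h' := congrArg (Multiset.map ii.symm) h
  rw [Multiset.map_map, Multiset.map_map] at h'
  funext m
  exact ii.symm.injective
    (congrFun ((symm_wordOf_mono hn ii _).eq_of_map_univ_eq hw h') m)

theorem sortKey_wordOf_mono {ℓ n : ℕ} (hn : 0 < n) (ii : Equiv.Perm (Fin n)) (γ : Fin n → ℕ)
    (d : Fin ℓ → ℕ)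
    (hd : ∀ (m : ℕ) (h : m + 1 < ℓ), blockOf hn ii γ m = blockOf hn ii γ (m + 1) →
      d ⟨m + 1, h⟩ ≤ d ⟨m, Nat.lt_of_succ_lt h⟩) :
    Monotone (sortKey ii (wordOf hn ii γ) d) := by
  obtain _ | k := ℓ
  · exact fun i => i.elim0
  refine Fin.monotone_iff_le_succ.mpr fun i => Prod.Lex.toLex_le_toLex.mpr ?_
  have hle := blockOf_mono hn ii γ (Nat.le_succ (i : ℕ))
  refine hle.lt_or_eq.imp (fun h => ?_) fun h => ⟨?_, ?_⟩
  · simpa [wordOf] using h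
  · simpa [wordOf] using h
  · exact hd i (by omega) h

theorem le_of_sortKey_mono {ℓ n : ℕ} (hn : 0 < n) (ii : Equiv.Perm (Fin n)) (γ : Fin n → ℕ)
    (d : Fin ℓ → ℕ) (hmono : Monotone (sortKey ii (wordOf hn ii γ) d)) (m : ℕ) (h : m + 1 < ℓ)
    (hb : blockOf hn ii γ m = blockOf hn ii γ (m + 1)) :
    d ⟨m + 1, h⟩ ≤ d ⟨m, Nat.lt_of_succ_lt h⟩ := by
  have hle : (⟨m, Nat.lt_of_succ_lt h⟩ : Fin ℓ) ≤ ⟨m + 1, h⟩ := Nat.le_succ m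
  rcases Prod.Lex.toLex_le_toLex.mp (hmono hle) with hlt | ⟨-, hd⟩
  · simp [wordOf, hb] at hlt
  · exact hd

/-! ## The orbit basis -/

/-- The basis vector `y^d ⊗ u_w` of `P ⊗ (ℂ^n)^{⊗ℓ}`. -/
def monoWord {ℓ n : ℕ} (w : Word ℓ n) (d : Fin ℓ → ℕ) : PW ℓ n :=
  Pi.single w (MvPolynomial.monomial (Finsupp.equivFunOnFinite.symm d) 1)

theorem belt_eq_monoWord {ℓ n : ℕ} (hn : 0 < n) (ii : Equiv.Perm (Fin n)) (γ : Fin n → ℕ)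
    (d : Fin ℓ → ℕ) : belt hn ii γ d = monoWord (wordOf hn ii γ) d := by
  funext w
  simp only [belt, monoWord, Pi.single_apply]
  split_ifs with h
  · rw [MvPolynomial.monomial_eq, Finsupp.prod_fintype _ _ (by simp)]
    simp
  · rfl

/-- The vectors `y^d ⊗ u_w` as a basis of `P ⊗ (ℂ^n)^{⊗ℓ}`. -/
def monoWordBasis (ℓ n : ℕ) :
    Module.Basis (Σ _ : Word ℓ n, Fin ℓ →₀ ℕ) ℂ (PW ℓ n) :=
  Pi.basis fun _ => MvPolynomial.basisMonomials (Fin ℓ) ℂ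

theorem monoWordBasis_apply {ℓ n : ℕ} (x : Σ _ : Word ℓ n, Fin ℓ →₀ ℕ) :
    monoWordBasis ℓ n x = monoWord x.1 x.2 := by
  rw [monoWordBasis, Pi.basis_apply, monoWord, MvPolynomial.coe_basisMonomials]
  congr 2
  ext
  simp

theorem sgnOp_monoWord {ℓ n : ℕ} (σ : Equiv.Perm (Fin ℓ)) (w : Word ℓ n) (d : Fin ℓ → ℕ) :
    sgnOp n σ (monoWord (w ∘ σ) (d ∘ σ)) =
      ((Equiv.Perm.sign σ : ℤ) : ℂ) • monoWord w d := by
  rw [sgnOp, LinearMap.smul_apply]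
  congr 1
  funext v
  change MvPolynomial.rename σ (monoWord (w ∘ σ) (d ∘ σ) (v ∘ σ)) = _
  simp only [monoWord, Pi.single_apply, σ.surjective.injective_comp_right.eq_iff]
  split_ifs
  · rw [MvPolynomial.rename_monomial]
    congr 2
    ext i
    rw [Finsupp.mapDomain_equiv_apply]
    simp
  · simp

theorem sgnOp_swap_monoWord {ℓ n : ℕ} {i j : Fin ℓ} (hij : i ≠ j) (w : Word ℓ n)
    (d : Fin ℓ → ℕ) :
    sgnOp n (Equiv.swap i j) (monoWord w d) =
      -monoWord (w ∘ Equiv.swap i j) (d ∘ Equiv.swap i j) := by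
  have h := sgnOp_monoWord (Equiv.swap i j) (w ∘ Equiv.swap i j) (d ∘ Equiv.swap i j)
  have hs : (Equiv.swap i j : Fin ℓ → Fin ℓ) ∘ Equiv.swap i j = id := by
    funext x
    simp
  rw [Function.comp_assoc, Function.comp_assoc, hs, Function.comp_id, Function.comp_id] at h
  rw [h, Equiv.Perm.sign_swap hij]
  simp

theorem mkQ_monoWord_swap {ℓ n : ℕ} (i : Fin ℓ) (h : (i : ℕ) + 1 < ℓ) (w : Word ℓ n)
    (d : Fin ℓ → ℕ) :
    (NPsub n ℓ).mkQ (monoWord (w ∘ Equiv.swap i ⟨i + 1, h⟩) (d ∘ Equiv.swap i ⟨i + 1, h⟩)) =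
      (NPsub n ℓ).mkQ (monoWord w d) := by
  symm
  rw [← sub_eq_zero, ← map_sub, Submodule.mkQ_apply, Submodule.Quotient.mk_eq_zero]
  refine Submodule.mem_iSup_of_mem i (Submodule.mem_iSup_of_mem h ⟨monoWord w d, ?_⟩)
  have hne : i ≠ ⟨i + 1, h⟩ := fun e => by simpa using congrArg Fin.val e
  rw [LinearMap.add_apply, sgnOp_swap_monoWord hne, LinearMap.id_apply]
  abel

theorem mkQ_monoWord_perm {ℓ n : ℕ} (σ : Equiv.Perm (Fin ℓ)) (w : Word ℓ n) (d : Fin ℓ → ℕ) :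
    (NPsub n ℓ).mkQ (monoWord (w ∘ σ) (d ∘ σ)) = (NPsub n ℓ).mkQ (monoWord w d) := by
  obtain _ | k := ℓ
  · rw [Subsingleton.elim σ 1]
    rfl
  have hσ : σ ∈ Submonoid.closure
      (Set.range fun i : Fin k => Equiv.swap i.castSucc i.succ) := by
    rw [Equiv.Perm.mclosure_swap_castSucc_succ]
    trivial
  induction hσ using Submonoid.closure_induction generalizing w d with
  | mem τ hτ =>
    obtain ⟨i, rfl⟩ := hτ
    exact mkQ_monoWord_swap i.castSucc (by simp) w d
  | one => rfl
  | mul σ τ _ _ hσ hτ =>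
    rw [Equiv.Perm.coe_mul, ← Function.comp_assoc, ← Function.comp_assoc, hτ, hσ]

/-- The linear map sending `y^d ⊗ u_w` to the basis vector of its orbit. -/
def contentMap (ℓ n : ℕ) : PW ℓ n →ₗ[ℂ] (Multiset (Fin n × ℕ) →₀ ℂ) :=
  (monoWordBasis ℓ n).constr ℂ fun x => Finsupp.single (content x.1 x.2) 1

theorem contentMap_monoWord {ℓ n : ℕ} (w : Word ℓ n) (d : Fin ℓ → ℕ) :
    contentMap ℓ n (monoWord w d) = Finsupp.single (content w d) 1 := by
  have h := (monoWordBasis ℓ n).constr_basis ℂ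
    (fun x => Finsupp.single (content x.1 x.2) (1 : ℂ)) ⟨w, Finsupp.equivFunOnFinite.symm d⟩
  rwa [monoWordBasis_apply] at h

theorem NPsub_le_ker_contentMap (ℓ n : ℕ) : NPsub n ℓ ≤ LinearMap.ker (contentMap ℓ n) := by
  refine iSup₂_le fun i h => ?_
  rw [LinearMap.range_le_ker_iff]
  refine (monoWordBasis ℓ n).ext fun x => ?_
  have hne : i ≠ ⟨i + 1, h⟩ := fun e => by simpa using congrArg Fin.val e
  rw [monoWordBasis_apply, LinearMap.comp_apply, LinearMap.add_apply, sgnOp_swap_monoWord hne,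
    LinearMap.id_apply, map_add, map_neg, contentMap_monoWord, contentMap_monoWord,
    content_comp_perm]
  simp

/-- Fix a permutation `(i_1,…,i_n)` of `(1,…,n)`. The classes
`[y_1^{d_1} ⋯ y_ℓ^{d_ℓ} ⊗ u_𝐢(γ)]`, where `γ` ranges over `ℤ_{≥0}^n` with `Σ γ_a = ℓ`
and `(d_1,…,d_ℓ)` over tuples satisfying `d_m ≥ d_{m+1}` whenever `m` and `m+1` lie in
the same block, form a `ℂ`-basis of `D̄_ℓ`. -/
theorem statement14 (n ℓ : ℕ) (hn : 0 < n) (hℓ : 0 < ℓ) (ii : Equiv.Perm (Fin n)) :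
    LinearIndependent ℂ
      (fun p : {p : (Fin n → ℕ) × (Fin ℓ → ℕ) //
          (∑ a, p.1 a) = ℓ ∧
          ∀ (m : ℕ) (h : m + 1 < ℓ),
            blockOf hn ii p.1 m = blockOf hn ii p.1 (m + 1) →
              p.2 ⟨m + 1, h⟩ ≤ p.2 ⟨m, Nat.lt_of_succ_lt h⟩} =>
        (NPsub n ℓ).mkQ (belt hn ii p.1.1 p.1.2)) ∧
    Submodule.span ℂ
      (Set.range
        (fun p : {p : (Fin n → ℕ) × (Fin ℓ → ℕ) //
            (∑ a, p.1 a) = ℓ ∧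
            ∀ (m : ℕ) (h : m + 1 < ℓ),
              blockOf hn ii p.1 m = blockOf hn ii p.1 (m + 1) →
                p.2 ⟨m + 1, h⟩ ≤ p.2 ⟨m, Nat.lt_of_succ_lt h⟩} =>
          (NPsub n ℓ).mkQ (belt hn ii p.1.1 p.1.2))) = ⊤ := by
  refine ⟨?_, ?_⟩
  · refine LinearIndependent.of_comp
      ((NPsub n ℓ).liftQ (contentMap ℓ n) (NPsub_le_ker_contentMap ℓ n)) ?_
    have hinj : Function.Injective
        (fun p : {p : (Fin n → ℕ) × (Fin ℓ → ℕ) //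
          (∑ a, p.1 a) = ℓ ∧
          ∀ (m : ℕ) (h : m + 1 < ℓ),
            blockOf hn ii p.1 m = blockOf hn ii p.1 (m + 1) →
              p.2 ⟨m + 1, h⟩ ≤ p.2 ⟨m, Nat.lt_of_succ_lt h⟩} =>
        content (wordOf hn ii p.1.1 : Word ℓ n) p.1.2) := by
      rintro ⟨⟨γ, d⟩, hγ, hd⟩ ⟨⟨γ', d'⟩, hγ', hd'⟩ h
      have hkey := (sortKey_wordOf_mono hn ii γ d hd).eq_of_map_univ_eq
        (sortKey_wordOf_mono hn ii γ' d' hd') (by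
          rw [map_sortKey, map_sortKey]
          exact congrArg _ h)
      obtain ⟨hw, rfl⟩ := eq_of_sortKey_eq hkey
      have : γ = γ' := by
        funext a
        rw [← card_wordOf_eq hn ii γ hγ a, hw, card_wordOf_eq hn ii γ' hγ' a]
      subst this
      rfl
    convert (Finsupp.basisSingleOne (R := ℂ)).linearIndependent.comp _ hinj using 1
    funext p
    simp [belt_eq_monoWord, contentMap_monoWord]
    rfl
  · rw [eq_top_iff, ← (NPsub n ℓ).range_mkQ, LinearMap.range_eq_map,
      ← (monoWordBasis ℓ n).span_eq, Submodule.map_span, Submodule.span_le]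
    rintro _ ⟨_, ⟨⟨w, d⟩, rfl⟩, rfl⟩
    rw [monoWordBasis_apply]
    set σ := Tuple.sort (sortKey ii w d)
    have hmono : Monotone (sortKey ii (w ∘ σ) (d ∘ σ)) := Tuple.monotone_sort (sortKey ii w d)
    let γ : Fin n → ℕ := fun a => (Finset.univ.filter fun m => (w ∘ σ) m = a).card
    have hw : wordOf hn ii γ = w ∘ σ :=
      wordOf_card_eq hn ii (w ∘ σ) fun i j hij => Prod.Lex.monotone_fst _ _ (hmono hij)
    refine Submodule.subset_span ⟨⟨(γ, d ∘ σ), sum_card_letter (w ∘ σ),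
      le_of_sortKey_mono hn ii γ (d ∘ σ) (by rwa [hw])⟩, ?_⟩
    simp only [belt_eq_monoWord, hw]
    exact mkQ_monoWord_perm σ w d
end
end

section
/- For every k ∈ {1,…,n}, the smallest ℂ-subspace of D̄_ℓ containing the class [1 ⊗ u_k^{⊗ℓ}] and stable under the operators Θ_{ik}^{(r)} for all i ∈ {1,…,n} and all r ∈ ℤ_{≥0} is D̄_ℓ itself; that is, D̄_ℓ is generated from [1 ⊗ u_k^{⊗ℓ}] by the action of the elements E_{ik} ⊗ t^r of the current algebra gl_n[t]. -/
set_option synthInstance.maxHeartbeats 1000000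
set_option maxHeartbeats 1000000

noncomputable section

open scoped TensorProduct

/-- The monomial `y^d ⊗ u_w` of `P ⊗ (ℂ^n)^{⊗ℓ}`. -/
def wordMonomial {ℓ n : ℕ} (w : Word ℓ n) (d : Fin ℓ →₀ ℕ) : PW ℓ n :=
  Pi.single w (MvPolynomial.monomial d 1)

theorem sgnOp_wordMonomial {ℓ n : ℕ} (σ : Equiv.Perm (Fin ℓ)) (w : Word ℓ n) (d : Fin ℓ →₀ ℕ) :
    sgnOp n σ (wordMonomial w d) =
      ((Equiv.Perm.sign σ : ℤ) : ℂ) • wordMonomial (w ∘ σ.symm) (d.mapDomain σ) := by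
  rw [sgnOp, LinearMap.smul_apply]
  congr 1
  funext v
  by_cases h : v = w ∘ σ.symm
  · subst h
    simp [wordMonomial, permOp, Function.comp_assoc, MvPolynomial.rename_monomial]
  · have h' : v ∘ σ ≠ w := by
      rintro rfl
      exact h (by simp [Function.comp_assoc])
    simp [wordMonomial, permOp, h, h']

theorem mkQ_wordMonomial_perm {ℓ n : ℕ} (σ : Equiv.Perm (Fin ℓ)) (w : Word ℓ n)
    (d : Fin ℓ →₀ ℕ) :
    (NPsub n ℓ).mkQ (wordMonomial (w ∘ σ.symm) (d.mapDomain σ)) =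
      (NPsub n ℓ).mkQ (wordMonomial w d) := by
  obtain _ | l := ℓ
  · have hσ : σ = 1 := Subsingleton.elim _ _
    subst hσ
    simp [Equiv.Perm.one_def]
  have hσ : σ ∈ Submonoid.closure
      (Set.range fun i : Fin l => Equiv.swap i.castSucc i.succ) := by
    rw [Equiv.Perm.mclosure_swap_castSucc_succ]
    trivial
  induction hσ using Submonoid.closure_induction generalizing w d with
  | mem σ hσ =>
    obtain ⟨i, rfl⟩ := hσ
    have hi : (i.castSucc : ℕ) + 1 < l + 1 := by simp
    have hN : sgnOp n (Equiv.swap i.castSucc i.succ) (wordMonomial w d) + wordMonomial w d ∈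
        NPsub n (l + 1) :=
      Submodule.mem_iSup_of_mem i.castSucc
        (Submodule.mem_iSup_of_mem hi ⟨wordMonomial w d, rfl⟩)
    rw [sgnOp_wordMonomial, Equiv.Perm.sign_swap Fin.castSucc_lt_succ.ne] at hN
    rw [eq_comm, ← sub_eq_zero, ← map_sub, Submodule.mkQ_apply, Submodule.Quotient.mk_eq_zero]
    convert hN using 1
    simp [neg_add_eq_sub]
  | one => simp [Equiv.Perm.one_def]
  | mul σ τ _ _ hσ hτ =>
    rw [← hτ w d, ← hσ (w ∘ τ.symm), ← Finsupp.mapDomain_comp]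
    rfl

theorem thetaOp_wordMonomial {ℓ n : ℕ} (a b : Fin n) (r : ℕ) (w : Word ℓ n) (d : Fin ℓ →₀ ℕ) :
    thetaOp n a b r (wordMonomial w d) =
      ∑ m with w m = b, wordMonomial (Function.update w m a) (d + Finsupp.single m r) := by
  rw [thetaOp, LinearMap.sum_apply, Finset.sum_filter]
  refine Finset.sum_congr rfl fun m _ => ?_
  funext v
  by_cases hb : w m = b
  · by_cases hv : v = Function.update w m a
    · subst hv
      simp [wordMonomial, tauOp, ← hb, MvPolynomial.X_pow_eq_monomial,
        MvPolynomial.monomial_mul, add_comm]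
    · have hne : v m = a → Function.update v m b ≠ w := by
        rintro rfl rfl
        simp at hv
      by_cases ha : v m = a <;> simp [wordMonomial, tauOp, hb, hv, ha, hne]
  · have hne : Function.update v m b ≠ w := by
      rintro rfl
      simp at hb
    simp [wordMonomial, tauOp, hb, hne]

theorem eq_top_of_wordMonomial_mem {ℓ n : ℕ} {p : Submodule ℂ (PW ℓ n)}
    (h : ∀ w d, wordMonomial w d ∈ p) : p = ⊤ := by
  rw [eq_top_iff]
  intro f _
  rw [← Finset.univ_sum_single f]
  refine Submodule.sum_mem _ fun w _ => ?_
  induction f w using MvPolynomial.induction_on' with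
  | monomial d c =>
    convert p.smul_mem c (h w d) using 1
    rw [wordMonomial, ← Pi.single_smul, MvPolynomial.smul_monomial, smul_eq_mul, mul_one]
  | add P Q hP hQ =>
    rw [Pi.single_add]
    exact p.add_mem hP hQ

/-- For `w`, `d` trivial at `m` and `m'`, modifying either place gives the same class. -/
theorem mkQ_wordMonomial_update_eq {ℓ n : ℕ} {w : Word ℓ n} {d : Fin ℓ →₀ ℕ} {m m' : Fin ℓ}
    (hw : w m = w m') (hd : d m = d m') (a : Fin n) (r : ℕ) :
    (NPsub n ℓ).mkQ (wordMonomial (Function.update w m a) (d + Finsupp.single m r)) =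
      (NPsub n ℓ).mkQ (wordMonomial (Function.update w m' a) (d + Finsupp.single m' r)) := by
  rw [← mkQ_wordMonomial_perm (Equiv.swap m m') (Function.update w m a)]
  congr 2
  · funext x
    rcases eq_or_ne x m with rfl | hx
    · rcases eq_or_ne m' x with rfl | hx' <;> simp [*, eq_comm]
    · rcases eq_or_ne x m' with rfl | hx'
      · simp
      · simp [Equiv.swap_apply_of_ne_of_ne, *]
  · ext x
    rw [Finsupp.mapDomain_equiv_apply]
    rcases eq_or_ne x m with rfl | hx
    · rcases eq_or_ne m' x with rfl | hx' <;> simp [*, eq_comm]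
    · rcases eq_or_ne x m' with rfl | hx'
      · simp [hd]
      · simp [Equiv.swap_apply_of_ne_of_ne, *]

theorem mkQ_wordMonomial_mem {ℓ n : ℕ} {k : Fin n} {q : Submodule ℂ (DBar ℓ n)}
    (hq : ∀ (i : Fin n) (r : ℕ) (f : PW ℓ n),
      (NPsub n ℓ).mkQ f ∈ q → (NPsub n ℓ).mkQ (thetaOp n i k r f) ∈ q)
    (h0 : (NPsub n ℓ).mkQ (wordMonomial (fun _ => k) 0) ∈ q) (S : Finset (Fin ℓ)) :
    ∀ (w : Word ℓ n) (d : Fin ℓ →₀ ℕ), (∀ m ∉ S, w m = k) → (∀ m ∉ S, d m = 0) →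
      (NPsub n ℓ).mkQ (wordMonomial w d) ∈ q := by
  induction S using Finset.induction_on with
  | empty =>
    intro w d hw hd
    obtain rfl : w = fun _ => k := funext fun m => hw m (by simp)
    obtain rfl : d = 0 := Finsupp.ext fun m => hd m (by simp)
    exact h0
  | insert m₀ S hm₀ ih =>
    intro w d hw hd
    set w' : Word ℓ n := Function.update w m₀ k with hw'_def
    set d' : Fin ℓ →₀ ℕ := d.erase m₀ with hd'_def
    have hw' : ∀ m ∉ S, w' m = k := by
      intro m hm
      rcases eq_or_ne m m₀ with rfl | h
      · simp [hw'_def]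
      · simpa [hw'_def, h] using hw m (by simp [h, hm])
    have hd' : ∀ m ∉ S, d' m = 0 := by
      intro m hm
      rcases eq_or_ne m m₀ with rfl | h
      · simp [hd'_def]
      · simpa [hd'_def, h] using hd m (by simp [h, hm])
    have key := hq (w m₀) (d m₀) _ (ih w' d' hw' hd')
    rw [thetaOp_wordMonomial, map_sum, ← Finset.sum_filter_add_sum_filter_not _ (· ∈ S),
      Submodule.add_mem_iff_right] at key
    · have hconst : ∀ m ∈ Finset.univ.filter (w' · = k) |>.filter (· ∉ S),
          (NPsub n ℓ).mkQ (wordMonomial (Function.update w' m (w m₀))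
            (d' + Finsupp.single m (d m₀))) = (NPsub n ℓ).mkQ (wordMonomial w d) := by
        intro m hm
        have hmS : m ∉ S := (Finset.mem_filter.mp hm).2
        rw [mkQ_wordMonomial_update_eq (m' := m₀) (by rw [hw' m hmS, hw' m₀ hm₀])
          (by rw [hd' m hmS, hd' m₀ hm₀])]
        simp [hw'_def, hd'_def, Finsupp.erase_add_single]
      rw [Finset.sum_congr rfl hconst, Finset.sum_const, ← Nat.cast_smul_eq_nsmul ℂ] at key
      refine (Submodule.smul_mem_iff _ ?_).mp key
      rw [Nat.cast_ne_zero]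
      exact Finset.card_ne_zero_of_mem (a := m₀) (by simp [hm₀, hw' m₀ hm₀])
    · refine Submodule.sum_mem _ fun m hm => ?_
      have hmS : m ∈ S := (Finset.mem_filter.mp hm).2
      refine ih _ _ (fun x hx => ?_) fun x hx => ?_
      · rw [Function.update_of_ne (ne_of_mem_of_not_mem hmS hx).symm, hw' x hx]
      · simp [hd' x hx, ne_of_mem_of_not_mem hmS hx]

/-- For every `k ∈ {1,…,n}`, the smallest subspace of `D̄_ℓ` containing
the class `[1 ⊗ u_k^{⊗ℓ}]` and stable under the (induced) operators `Θ_{ik}^{(r)}` for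
all `i` and all `r ≥ 0` is `D̄_ℓ` itself: `D̄_ℓ` is generated from `[1 ⊗ u_k^{⊗ℓ}]` by the
elements `E_{ik} ⊗ t^r` of the current algebra `gl_n[t]`. -/
theorem statement15 (n ℓ : ℕ) (hn : 0 < n) (hℓ : 0 < ℓ) (k : Fin n) :
    ∀ q : Submodule ℂ (DBar ℓ n),
      (∀ (i : Fin n) (r : ℕ) (f : PW ℓ n),
        (NPsub n ℓ).mkQ f ∈ q → (NPsub n ℓ).mkQ (thetaOp n i k r f) ∈ q) →
      (NPsub n ℓ).mkQ (fun w => if w = (fun _ : Fin ℓ => k) then 1 else 0) ∈ q →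
      q = ⊤ := by
  intro q hq h0
  have h0' : (NPsub n ℓ).mkQ (wordMonomial (fun _ => k) 0) ∈ q := by
    convert h0 using 2
    funext w
    simp [wordMonomial, Pi.single_apply]
  have hcomap : q.comap (NPsub n ℓ).mkQ = ⊤ :=
    eq_top_of_wordMonomial_mem fun w d =>
      mkQ_wordMonomial_mem hq h0' Finset.univ w d (by simp) (by simp)
  rw [eq_top_iff]
  intro x _
  obtain ⟨f, rfl⟩ := (NPsub n ℓ).mkQ_surjective x
  exact (hcomap.ge trivial : f ∈ q.comap (NPsub n ℓ).mkQ)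
end
end
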